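/- arXiv:1608.06094 — 4 statements merged into one kernel-verified Lean document; each statement's English description precedes it below -/
import Mathlib

section
/- Let n > 2 and let D = (diag(d⁽¹⁾),...,diag(d⁽ᵐ⁾)) and D̂ = (diag(d̂⁽¹⁾),...,diag(d̂⁽ᵐ⁾)) be m-tuples of n×n real diagonal matrices with d⁽ⁱ⁾, d̂⁽ⁱ⁾ ∈ ℝⁿ. If D̂ ≺ D, then for every linear map L : (H_n)^m → ℝ³ one has W_L(D̂) ⊆ W_L(D). -/
open Matrix

/-- The `L`-numerical range of an `m`-tuple of `n × n` complex matrices: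
`W_L(A) = { L(U*A₁U, ..., U*A_mU) : U unitary }`. -/
noncomputable def LNumericalRange {n m l : ℕ}
    (L : (Fin m → Matrix (Fin n) (Fin n) ℂ) →ₗ[ℝ] (Fin l → ℝ))
    (A : Fin m → Matrix (Fin n) (Fin n) ℂ) : Set (Fin l → ℝ) :=
  {y | ∃ U ∈ Matrix.unitaryGroup (Fin n) ℂ, y = L fun i => Uᴴ * A i * U}

/-- An `n × n` real matrix is a pinching matrix if for some `s < t` and `α ∈ [0,1]` its
`(s,s)` and `(t,t)` entries are `α`, its `(s,t)` and `(t,s)` entries are `1 − α`, the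
remaining diagonal entries are `1`, and all other entries vanish. -/
def IsPinching {n : ℕ} (P : Matrix (Fin n) (Fin n) ℝ) : Prop :=
  ∃ s t : Fin n, s < t ∧ ∃ α ∈ Set.Icc (0 : ℝ) 1,
    P = Matrix.of fun i j =>
      if i = s ∧ j = s then α
      else if i = t ∧ j = t then α
      else if i = s ∧ j = t then 1 - α
      else if i = t ∧ j = s then 1 - α
      else if i = j then 1 else 0

/-- `D̂ ≺ D` for tuples of diagonal matrices with diagonal vectors `dhat`, `d`: there are
finitely many pinching matrices `P₁, ..., P_k` with `dhat i = P₁P₂⋯P_k d i` for all `i`. -/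
def PinchPrec {n m : ℕ} (dhat d : Fin m → Fin n → ℝ) : Prop :=
  ∃ Ps : List (Matrix (Fin n) (Fin n) ℝ),
    (∀ P ∈ Ps, IsPinching P) ∧ ∀ i, dhat i = Ps.prod *ᵥ d i


lemma core_singular (M : Matrix (Fin 3) (Fin 3) ℝ) (hM : M.det = 0) (x : Fin 3 → ℝ)
    (hx : x ⬝ᵥ x ≤ 1) : ∃ y : Fin 3 → ℝ, y ⬝ᵥ y = 1 ∧ M *ᵥ y = M *ᵥ x := by
  obtain ⟨v, hv, hMv⟩ := Matrix.exists_mulVec_eq_zero_iff.mpr hM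
  have hvv : v ⬝ᵥ v ≠ 0 := by simpa using hv
  have hvp : 0 ≤ v ⬝ᵥ v := by
    simp only [dotProduct]
    exact Finset.sum_nonneg fun i _ => mul_self_nonneg _
  have hd : 0 ≤ discrim (v ⬝ᵥ v) (2 * (x ⬝ᵥ v)) (x ⬝ᵥ x - 1) := by
    unfold discrim
    nlinarith [sq_nonneg (x ⬝ᵥ v), mul_nonneg hvp (sub_nonneg.2 hx)]
  obtain ⟨c, hc⟩ := exists_quadratic_eq_zero hvv ⟨_, (Real.mul_self_sqrt hd).symm⟩
  refine ⟨x + c • v, ?_, ?_⟩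
  · simp only [add_dotProduct, dotProduct_add, smul_dotProduct, dotProduct_smul, smul_eq_mul]
    rw [dotProduct_comm v x]
    linarith
  · rw [mulVec_add, mulVec_smul, hMv]; simp

lemma core_top (q : unitInterval → Fin 3 → ℝ) (M : unitInterval → Matrix (Fin 3) (Fin 3) ℝ)
    (hq : Continuous q) (hM : Continuous M) (p x0 : Fin 3 → ℝ) (hx0 : x0 ⬝ᵥ x0 ≤ 1)
    (h0 : q 0 + M 0 *ᵥ x0 = p) (h1 : (M 1).det = 0) :
    ∃ t x, x ⬝ᵥ x = 1 ∧ q t + M t *ᵥ x = p := by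
  by_contra! hno
  have key : ∀ t x, x ⬝ᵥ x ≤ 1 → q t + M t *ᵥ x = p → x ⬝ᵥ x < 1 ∧ (M t).det ≠ 0 := by
    intro t x hx h
    refine ⟨lt_of_le_of_ne hx fun h' => hno t x h' h, fun hd => ?_⟩
    obtain ⟨y, hy, hy'⟩ := core_singular _ hd x hx
    exact hno t y hy (by rw [hy', h])
  let S : Set unitInterval := {t | ∃ x, x ⬝ᵥ x ≤ 1 ∧ q t + M t *ᵥ x = p}
  have hK : IsCompact {x : Fin 3 → ℝ | x ⬝ᵥ x ≤ 1} := by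
    refine Metric.isCompact_of_isClosed_isBounded ?_ ?_
    · exact isClosed_le (by unfold dotProduct; fun_prop) continuous_const
    · refine (Metric.isBounded_closedBall (x := (0 : Fin 3 → ℝ)) (r := 1)).subset ?_
      intro x hx
      rw [mem_closedBall_zero_iff, pi_norm_le_iff_of_nonneg zero_le_one]
      intro i
      rw [Real.norm_eq_abs, ← sq_le_one_iff_abs_le_one]
      have : x i * x i ≤ x ⬝ᵥ x :=
        Finset.single_le_sum (f := fun i => x i * x i) (fun j _ => mul_self_nonneg (x j)) (Finset.mem_univ i)
      have hx' : x ⬝ᵥ x ≤ 1 := hx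
      nlinarith
  have hclosed : IsClosed S := by
    have hc : IsCompact ((Set.univ ×ˢ {x : Fin 3 → ℝ | x ⬝ᵥ x ≤ 1}) ∩
        {z : unitInterval × (Fin 3 → ℝ) | q z.1 + M z.1 *ᵥ z.2 = p}) := by
      refine (isCompact_univ.prod hK).inter_right (isClosed_eq ?_ continuous_const)
      exact (hq.comp continuous_fst).add
        (Continuous.matrix_mulVec (hM.comp continuous_fst) continuous_snd)
    have := (hc.image continuous_fst).isClosed
    convert this using 1
    ext t
    simp [S]
  have hopen : IsOpen S := by
    rw [isOpen_iff_mem_nhds]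
    rintro t ⟨x, hx, h⟩
    obtain ⟨hx1, hd⟩ := key t x hx h
    let f : unitInterval → Fin 3 → ℝ := fun s => ((M s).det)⁻¹ • ((M s).adjugate *ᵥ (p - q s))
    have hf : ContinuousAt f t := by
      refine ContinuousAt.smul (ContinuousAt.inv₀ hM.matrix_det.continuousAt hd) ?_
      exact (Continuous.matrix_mulVec hM.matrix_adjugate (continuous_const.sub hq)).continuousAt
    have hft : f t = x := by
      simp only [f, ← h, add_sub_cancel_left, mulVec_mulVec, adjugate_mul, smul_mulVec, one_mulVec]
      rw [smul_smul, inv_mul_cancel₀ hd, one_smul]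
    have e1 : ∀ᶠ s in nhds t, f s ⬝ᵥ f s < 1 := by
      have : ContinuousAt (fun s => f s ⬝ᵥ f s) t := by
        have hg : Continuous (fun x : Fin 3 → ℝ => x ⬝ᵥ x) := by unfold dotProduct; fun_prop
        exact hg.continuousAt.comp hf
      exact this.eventually_lt continuousAt_const (by rw [hft]; exact hx1)
    have e2 : ∀ᶠ s in nhds t, (M s).det ≠ 0 := hM.matrix_det.continuousAt.eventually_ne hd
    filter_upwards [e1, e2] with s h1 h2
    refine ⟨f s, h1.le, ?_⟩
    simp only [f, mulVec_smul, mulVec_mulVec, mul_adjugate, smul_mulVec, one_mulVec]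
    rw [smul_smul, inv_mul_cancel₀ h2, one_smul]; simp
  have hS : S = Set.univ := IsClopen.eq_univ ⟨hclosed, hopen⟩ ⟨0, x0, hx0, h0⟩
  obtain ⟨x, hx, h⟩ : (1 : unitInterval) ∈ S := by rw [hS]; trivial
  exact (key 1 x hx h).2 h1

open scoped Matrix.Norms.L2Operator in
lemma unitary_path {n : ℕ} (V : Matrix (Fin n) (Fin n) ℂ) (hV : V ∈ unitaryGroup (Fin n) ℂ) :
    ∃ z : ℂ, star z * z = 1 ∧ ∃ γ : unitInterval → Matrix (Fin n) (Fin n) ℂ, Continuous γ ∧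
      (∀ t, γ t ∈ unitaryGroup (Fin n) ℂ) ∧ γ 0 = 1 ∧ γ 1 = z • V := by
  have hfin : (spectrum ℂ V).Finite := Matrix.finite_spectrum V
  have hinf : (Metric.sphere (0:ℂ) 1).Infinite := by
    refine (isPreconnected_sphere (by simp [Complex.rank_real_complex]) (0:ℂ) 1).infinite_of_nontrivial ?_
    exact ⟨1, by simp, -1, by simp, by norm_num⟩
  obtain ⟨w, hw, hwV⟩ := (hinf.sdiff hfin).nonempty
  have hw1 : ‖w‖ = 1 := by simpa using hw
  have hw0 : w ≠ 0 := by rintro rfl; simp at hw1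
  have hz : star (-w⁻¹) * (-w⁻¹) = 1 := by
    have := Complex.conj_mul' (-w⁻¹)
    simpa [hw1] using this
  refine ⟨-w⁻¹, hz, ?_⟩
  have hzV : (-w⁻¹) • V ∈ unitary (Matrix (Fin n) (Fin n) ℂ) := by
    have hV' := Unitary.mem_iff.1 hV
    rw [Unitary.mem_iff]
    constructor
    · rw [star_smul, smul_mul_smul_comm, hz, hV'.1, one_smul]
    · rw [star_smul, smul_mul_smul_comm, mul_comm, hz, hV'.2, one_smul]
  have hspec : (-1 : ℂ) ∉ spectrum ℂ ((-w⁻¹) • V) := by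
    intro h
    apply hwV
    have hu : IsUnit (-w⁻¹) := by simp [hw0]
    have h2 : (-w⁻¹) • w ∈ spectrum ℂ ((-w⁻¹) • V) := by
      rw [smul_eq_mul, neg_mul, inv_mul_cancel₀ hw0]; exact h
    have := (spectrum.smul_mem_smul_iff (r := hu.unit) (s := w) (a := V)).1 h2
    exact this
  have hn := (Unitary.norm_sub_one_lt_two_iff hzV).2 hspec
  obtain ⟨γ⟩ := Unitary.joined (1 : unitary (Matrix (Fin n) (Fin n) ℂ)) ⟨_, hzV⟩ (by simpa using hn)
  refine ⟨fun t => (γ t : Matrix _ _ ℂ), ?_, fun t => (γ t).2, by simp, by simp⟩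
  exact continuous_subtype_val.comp γ.continuous

/-- Traceless Hermitian 2×2 matrix with Bloch vector `x`. -/
noncomputable def Nmat (x : Fin 3 → ℝ) : Matrix (Fin 2) (Fin 2) ℂ :=
  !![(x 2 : ℂ), (x 0 : ℂ) - Complex.I * (x 1 : ℂ); (x 0 : ℂ) + Complex.I * (x 1 : ℂ), -(x 2 : ℂ)]

lemma Nmat_herm (x : Fin 3 → ℝ) : (Nmat x)ᴴ = Nmat x := by
  ext i j
  fin_cases i <;> fin_cases j <;> simp [Nmat, sub_eq_add_neg]

lemma Nmat_sq (x : Fin 3 → ℝ) (hx : x ⬝ᵥ x = 1) : Nmat x * Nmat x = 1 := by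
  have h : (x 0 : ℂ) * x 0 + x 1 * x 1 + x 2 * x 2 = 1 := by
    rw [dotProduct, Fin.sum_univ_three] at hx
    exact_mod_cast hx
  ext i j
  fin_cases i <;> fin_cases j <;> simp [Nmat, Matrix.mul_apply, Fin.sum_univ_two] <;> ring_nf <;>
    simp only [Complex.I_sq] <;> linear_combination h

/-- the linear map version -/
noncomputable def NmatL : (Fin 3 → ℝ) →ₗ[ℝ] Matrix (Fin 2) (Fin 2) ℂ where
  toFun := Nmat
  map_add' x y := by
    ext i j
    fin_cases i <;> fin_cases j <;> simp [Nmat] <;> ring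
  map_smul' c x := by
    ext i j
    fin_cases i <;> fin_cases j <;> simp [Nmat] <;> ring

lemma Nmat_reflect (x : Fin 3 → ℝ) (hx : x ⬝ᵥ x = 1) :
    ∃ u : Fin 3 → ℝ, u ⬝ᵥ u = 1 ∧ Nmat u * Nmat ![0, 0, 1] * Nmat u = Nmat x := by
  have hx' := hx
  rw [dotProduct, Fin.sum_univ_three] at hx
  have key : ∀ u : Fin 3 → ℝ, u ⬝ᵥ u = 1 → x 0 = 2 * u 2 * u 0 → x 1 = 2 * u 2 * u 1 →
      x 2 = 2 * u 2 * u 2 - 1 → Nmat u * Nmat ![0, 0, 1] * Nmat u = Nmat x := by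
    intro u hu h0 h1 h2
    have h : (u 0 : ℂ) * u 0 + u 1 * u 1 + u 2 * u 2 = 1 := by
      rw [dotProduct, Fin.sum_univ_three] at hu
      exact_mod_cast hu
    have h0' : (x 0 : ℂ) = 2 * u 2 * u 0 := by exact_mod_cast h0
    have h1' : (x 1 : ℂ) = 2 * u 2 * u 1 := by exact_mod_cast h1
    have h2' : (x 2 : ℂ) = 2 * u 2 * u 2 - 1 := by exact_mod_cast h2
    ext i j
    fin_cases i <;> fin_cases j <;> simp [Nmat, Matrix.mul_apply, Fin.sum_univ_two, h0', h1', h2'] <;>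
      ring_nf <;> simp only [Complex.I_sq] <;> first | linear_combination h | linear_combination -h
  by_cases h : x 2 = -1
  · have h01 : x 0 * x 0 + x 1 * x 1 = 0 := by rw [h] at hx; linarith
    have h0 : x 0 = 0 := by nlinarith [mul_self_nonneg (x 0), mul_self_nonneg (x 1)]
    have h1 : x 1 = 0 := by nlinarith [mul_self_nonneg (x 0), mul_self_nonneg (x 1)]
    refine ⟨![1, 0, 0], by simp [dotProduct, Fin.sum_univ_three], ?_⟩
    apply key <;> simp [dotProduct, Fin.sum_univ_three, h, h0, h1]
  · have hlt : 0 < 1 + x 2 := by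
      have : -1 ≤ x 2 := by nlinarith [mul_self_nonneg (x 0), mul_self_nonneg (x 1)]
      have := lt_of_le_of_ne this (Ne.symm h)
      linarith
    set c := Real.sqrt (2 * (1 + x 2)) with hc
    have hcc : c * c = 2 * (1 + x 2) := Real.mul_self_sqrt (by linarith)
    have hc0 : c ≠ 0 := by
      intro h0; rw [h0] at hcc; linarith
    have hu : (![x 0 / c, x 1 / c, (1 + x 2) / c] : Fin 3 → ℝ) ⬝ᵥ
        ![x 0 / c, x 1 / c, (1 + x 2) / c] = 1 := by
      simp only [dotProduct, Fin.sum_univ_three]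
      simp
      field_simp
      rw [pow_two c, hcc]
      linarith
    refine ⟨_, hu, key _ hu ?_ ?_ ?_⟩ <;> simp <;> field_simp <;> rw [pow_two c, hcc] <;> ring

lemma refl_exists {n : ℕ} (J : Matrix (Fin n) (Fin 2) ℂ) (hJ : Jᴴ * J = 1) (x : Fin 3 → ℝ)
    (hx : x ⬝ᵥ x = 1) : ∃ R ∈ unitaryGroup (Fin n) ℂ,
      ∀ (T : Matrix (Fin n) (Fin n) ℂ) (m δ : ℂ), T * J = m • J → Jᴴ * T = m • Jᴴ →
        Rᴴ * (T + δ • (J * Nmat ![0, 0, 1] * Jᴴ)) * R = T + δ • (J * Nmat x * Jᴴ) := by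
  obtain ⟨u, hu, hux⟩ := Nmat_reflect x hx
  have hB := Nmat_sq u hu
  have hBh := Nmat_herm u
  set B := Nmat u
  have hJ' : ∀ X : Matrix (Fin 2) (Fin n) ℂ, Jᴴ * (J * X) = X := fun X => by
    rw [← Matrix.mul_assoc, hJ, Matrix.one_mul]
  have hB' : ∀ X : Matrix (Fin 2) (Fin n) ℂ, B * (B * X) = X := fun X => by
    rw [← Matrix.mul_assoc, hB, Matrix.one_mul]
  have hRh : (J * B * Jᴴ + (1 - J * Jᴴ))ᴴ = J * B * Jᴴ + (1 - J * Jᴴ) := by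
    simp [conjTranspose_mul, hBh, Matrix.mul_assoc]
  have hRR : (J * B * Jᴴ + (1 - J * Jᴴ)) * (J * B * Jᴴ + (1 - J * Jᴴ)) = 1 := by
    simp only [Matrix.mul_add, Matrix.add_mul, Matrix.mul_sub, Matrix.sub_mul, Matrix.mul_assoc,
      hJ', hB', Matrix.one_mul, Matrix.mul_one]
    abel
  refine ⟨J * B * Jᴴ + (1 - J * Jᴴ), ?_, ?_⟩
  · rw [mem_unitaryGroup_iff, star_eq_conjTranspose, hRh, hRR]
  · intro T m δ h1 h2
    have hcomm : (J * B * Jᴴ + (1 - J * Jᴴ)) * T = T * (J * B * Jᴴ + (1 - J * Jᴴ)) := by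
      have h1' : ∀ X : Matrix (Fin 2) (Fin n) ℂ, T * (J * X) = m • (J * X) := fun X => by
        rw [← Matrix.mul_assoc, h1, Matrix.smul_mul]
      simp only [Matrix.mul_add, Matrix.add_mul, Matrix.mul_sub, Matrix.sub_mul, Matrix.mul_assoc,
        h1', h2, Matrix.one_mul, Matrix.mul_one, Matrix.mul_smul]
    rw [hRh, Matrix.mul_add _ T, Matrix.add_mul _ _ (J * B * Jᴴ + (1 - J * Jᴴ)), hcomm,
      Matrix.mul_assoc T, hRR, Matrix.mul_one]
    congr 1
    rw [Matrix.mul_smul, Matrix.smul_mul, ← hux]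
    congr 1
    simp only [Matrix.mul_add, Matrix.add_mul, Matrix.mul_sub, Matrix.sub_mul, Matrix.mul_assoc,
      hJ', Matrix.one_mul, Matrix.mul_one]
    abel

/-- embedding of the coordinates `s, t` -/
noncomputable def Jmat {n : ℕ} (s t : Fin n) : Matrix (Fin n) (Fin 2) ℂ :=
  Matrix.of fun i => ![if i = s then 1 else 0, if i = t then 1 else 0]

lemma Jmat_iso {n : ℕ} {s t : Fin n} (h : s ≠ t) : (Jmat s t)ᴴ * Jmat s t = 1 := by
  ext i j
  fin_cases i <;> fin_cases j <;> simp [Jmat, Matrix.mul_apply, h, h.symm, apply_ite (starRingEnd ℂ)]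

lemma Jmat_conj_entry {n : ℕ} (s t : Fin n) (B : Matrix (Fin 2) (Fin 2) ℂ) (i j : Fin n) :
    (Jmat s t * B * (Jmat s t)ᴴ) i j =
      (if i = s then 1 else 0) * B 0 0 * (if j = s then 1 else 0) +
      (if i = s then 1 else 0) * B 0 1 * (if j = t then 1 else 0) +
      (if i = t then 1 else 0) * B 1 0 * (if j = s then 1 else 0) +
      (if i = t then 1 else 0) * B 1 1 * (if j = t then 1 else 0) := by
  simp only [Matrix.mul_apply, Fin.sum_univ_two, Jmat, conjTranspose_apply, of_apply, apply_ite star,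
    star_one, star_zero, cons_val_zero, cons_val_one]
  ring

/-- the part commuting with the block -/
noncomputable def Tmat {n : ℕ} (s t : Fin n) (d : Fin n → ℝ) : Matrix (Fin n) (Fin n) ℂ :=
  Matrix.diagonal fun j => if j = s ∨ j = t then (((d s + d t) / 2 : ℝ) : ℂ) else (d j : ℂ)

lemma Tmat_J {n : ℕ} (s t : Fin n) (d : Fin n → ℝ) :
    Tmat s t d * Jmat s t = (((d s + d t) / 2 : ℝ) : ℂ) • Jmat s t := by
  ext i k
  fin_cases k <;> by_cases h1 : i = s <;> by_cases h2 : i = t <;>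
    simp [Tmat, Jmat, Matrix.diagonal_mul, h1, h2]

lemma J_Tmat {n : ℕ} (s t : Fin n) (d : Fin n → ℝ) :
    (Jmat s t)ᴴ * Tmat s t d = (((d s + d t) / 2 : ℝ) : ℂ) • (Jmat s t)ᴴ := by
  ext k i
  fin_cases k <;> by_cases h1 : i = s <;> by_cases h2 : i = t <;>
    simp [Tmat, Jmat, Matrix.mul_diagonal, h1, h2]

lemma diag_eq {n : ℕ} {s t : Fin n} (hst : s ≠ t) (d : Fin n → ℝ) :
    (Matrix.diagonal fun j => (d j : ℂ)) =
      Tmat s t d + (((d s - d t) / 2 : ℝ) : ℂ) • (Jmat s t * Nmat ![0, 0, 1] * (Jmat s t)ᴴ) := by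
  ext i j
  rw [Matrix.add_apply, Matrix.smul_apply, Jmat_conj_entry]
  by_cases hij : i = j
  · subst hij
    by_cases h1 : i = s
    · subst h1; simp [Tmat, Nmat, hst]; ring
    · by_cases h2 : i = t
      · subst h2; simp [Tmat, Nmat, h1]; ring
      · simp [Tmat, h1, h2]
  · by_cases h1 : i = s <;> by_cases h2 : i = t <;> by_cases h3 : j = s <;> by_cases h4 : j = t <;>
      simp_all [Tmat, Nmat]

lemma pinch_eq {n : ℕ} {s t : Fin n} (hst : s ≠ t) (α : ℝ) (P : Matrix (Fin n) (Fin n) ℝ)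
    (hP : P = Matrix.of fun i j =>
      if i = s ∧ j = s then α
      else if i = t ∧ j = t then α
      else if i = s ∧ j = t then 1 - α
      else if i = t ∧ j = s then 1 - α
      else if i = j then 1 else 0) (d : Fin n → ℝ) :
    (Matrix.diagonal fun j => ((P *ᵥ d) j : ℂ)) =
      Tmat s t d + (((d s - d t) / 2 : ℝ) : ℂ) •
        (Jmat s t * Nmat ![0, 0, 2 * α - 1] * (Jmat s t)ᴴ) := by
  have hs : (P *ᵥ d) s = α * d s + (1 - α) * d t := by
    have : ∀ j, P s j * d j = (if j = s then α * d s else 0) + if j = t then (1 - α) * d t else 0 := by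
      intro j
      by_cases h1 : j = s <;> by_cases h2 : j = t <;> simp_all [eq_comm]
    simp [mulVec, dotProduct, this, Finset.sum_add_distrib]
  have ht : (P *ᵥ d) t = (1 - α) * d s + α * d t := by
    have : ∀ j, P t j * d j = (if j = s then (1 - α) * d s else 0) + if j = t then α * d t else 0 := by
      intro j
      by_cases h1 : j = s <;> by_cases h2 : j = t <;> simp_all [eq_comm]
    simp [mulVec, dotProduct, this, Finset.sum_add_distrib]
  have ho : ∀ i, i ≠ s → i ≠ t → (P *ᵥ d) i = d i := by
    intro i h1 h2
    simp [mulVec, dotProduct, hP, h1, h2]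
  have hv : (P *ᵥ d) = fun j => if j = s then α * d s + (1 - α) * d t else
      if j = t then (1 - α) * d s + α * d t else d j := by
    funext j
    split_ifs with h1 h2
    · rw [h1, hs]
    · rw [h2, ht]
    · exact ho j h1 h2
  rw [hv]
  ext i j
  rw [Matrix.add_apply, Matrix.smul_apply, Jmat_conj_entry]
  by_cases hij : i = j
  · subst hij
    by_cases h1 : i = s
    · subst h1; simp [Tmat, Nmat, hst]; ring
    · by_cases h2 : i = t
      · subst h2; simp [Tmat, Nmat, h1]; ring
      · simp [Tmat, h1, h2]
  · by_cases h1 : i = s <;> by_cases h2 : i = t <;> by_cases h3 : j = s <;> by_cases h4 : j = t <;>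
      simp_all [Tmat, Nmat]

lemma diag_rotate {n : ℕ} {s t : Fin n} (hst : s ≠ t) (x : Fin 3 → ℝ) (hx : x ⬝ᵥ x = 1) :
    ∃ R ∈ unitaryGroup (Fin n) ℂ, ∀ d : Fin n → ℝ,
      Rᴴ * (Matrix.diagonal fun j => (d j : ℂ)) * R =
        Tmat s t d + (((d s - d t) / 2 : ℝ) : ℂ) • (Jmat s t * Nmat x * (Jmat s t)ᴴ) := by
  obtain ⟨R, hR, h⟩ := refl_exists (Jmat s t) (Jmat_iso hst) x hx
  refine ⟨R, hR, fun d => ?_⟩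
  rw [diag_eq hst d]
  exact h _ _ _ (Tmat_J s t d) (J_Tmat s t d)

lemma Jmat_compress {n : ℕ} (s t : Fin n) (X : Matrix (Fin n) (Fin n) ℂ) :
    (Jmat s t)ᴴ * X * Jmat s t = !![X s s, X s t; X t s, X t t] := by
  ext i j
  fin_cases i <;> fin_cases j <;>
    simp [Matrix.mul_apply, Jmat, conjTranspose_apply, apply_ite (starRingEnd ℂ)]

lemma scalar_compress_sorted {n : ℕ} {s t r : Fin n} (hst : s ≠ t) (hsr : s ≠ r) (htr : t ≠ r)
    (μ : Fin n → ℝ) (z : ℝ) (hz : z ∈ Set.Icc (-1 : ℝ) 1)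
    (hμ : (μ t + μ r) / 2 + (μ t - μ r) / 2 * z = μ s) :
    ∃ R ∈ unitaryGroup (Fin n) ℂ, ∃ c : ℂ,
      (Jmat s t)ᴴ * (Rᴴ * (Matrix.diagonal fun j => (μ j : ℂ)) * R) * Jmat s t = c • 1 := by
  have hx : (![Real.sqrt (1 - z ^ 2), 0, z] : Fin 3 → ℝ) ⬝ᵥ ![Real.sqrt (1 - z ^ 2), 0, z] = 1 := by
    have : 0 ≤ 1 - z ^ 2 := by nlinarith [hz.1, hz.2]
    simp only [dotProduct, Fin.sum_univ_three]
    simp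
    rw [Real.mul_self_sqrt this]; ring
  obtain ⟨R, hR, h⟩ := diag_rotate htr _ hx
  refine ⟨R, hR, (μ s : ℂ), ?_⟩
  have hμ' : ((μ t : ℂ) + μ r) / 2 + (μ t - μ r) / 2 * z = μ s := by exact_mod_cast hμ
  rw [h, Jmat_compress]
  ext i j
  fin_cases i <;> fin_cases j <;>
    simp [Jmat_conj_entry, Tmat, hst, hst.symm, hsr, htr, Nmat, hμ']

lemma exists_z (a b c : ℝ) (h : (b ≤ a ∧ a ≤ c) ∨ (c ≤ a ∧ a ≤ b)) :
    ∃ z ∈ Set.Icc (-1 : ℝ) 1, (b + c) / 2 + (b - c) / 2 * z = a := by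
  by_cases hbc : b = c
  · refine ⟨0, by simp, ?_⟩
    subst hbc
    rcases h with h | h <;> linarith [h.1, h.2]
  · have hne : b - c ≠ 0 := sub_ne_zero.2 hbc
    refine ⟨(2 * a - b - c) / (b - c), ?_, by field_simp; ring⟩
    rw [Set.mem_Icc, ← abs_le, abs_div, div_le_one (abs_pos.2 hne)]
    rcases h with h | h
    · rw [abs_of_nonpos (by linarith [h.1, h.2] : b - c ≤ 0), abs_le]
      constructor <;> linarith [h.1, h.2]
    · rw [abs_of_nonneg (by linarith [h.1, h.2] : 0 ≤ b - c), abs_le]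
      constructor <;> linarith [h.1, h.2]

lemma perm_conj {n : ℕ} (π : Equiv.Perm (Fin n)) : ∃ P ∈ unitaryGroup (Fin n) ℂ,
    ∀ v : Fin n → ℂ, P * Matrix.diagonal v * Pᴴ = Matrix.diagonal (v ∘ π) := by
  have key : ∀ v : Fin n → ℂ, ((1 : Matrix (Fin n) (Fin n) ℂ).submatrix π id) * Matrix.diagonal v *
      ((1 : Matrix (Fin n) (Fin n) ℂ).submatrix π id)ᴴ = Matrix.diagonal (v ∘ π) := by
    intro v
    ext i j
    simp [Matrix.mul_apply, one_apply, diagonal_apply]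
    split_ifs with h <;> simp [h]
  refine ⟨_, ?_, key⟩
  rw [mem_unitaryGroup_iff, star_eq_conjTranspose]
  have := key 1
  simpa [Pi.one_comp] using this

lemma scalar_compress {n : ℕ} (hn : 2 < n) {s t : Fin n} (hst : s ≠ t) (lam : Fin n → ℝ) :
    ∃ Y ∈ unitaryGroup (Fin n) ℂ, ∃ c : ℂ,
      (Jmat s t)ᴴ * (Y * (Matrix.diagonal fun j => (lam j : ℂ)) * Yᴴ) * Jmat s t = c • 1 := by
  obtain ⟨r, hr⟩ : ∃ r, r ∉ ({s, t} : Finset (Fin n)) := by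
    by_contra! h
    have : Finset.univ ⊆ ({s, t} : Finset (Fin n)) := fun x _ => h x
    have := Finset.card_le_card this
    have h2 := Finset.card_le_two (a := s) (b := t)
    simp at this
    omega
  simp only [Finset.mem_insert, Finset.mem_singleton, not_or] at hr
  obtain ⟨hrs, hrt⟩ := hr
  have hπ : ∃ π : Equiv.Perm (Fin n), (lam (π t) ≤ lam (π s) ∧ lam (π s) ≤ lam (π r)) ∨
      (lam (π r) ≤ lam (π s) ∧ lam (π s) ≤ lam (π t)) := by
    have e1 : Equiv.swap s t r = r := Equiv.swap_apply_of_ne_of_ne hrs hrt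
    have e2 : Equiv.swap s r t = t := Equiv.swap_apply_of_ne_of_ne hst.symm (Ne.symm hrt)
    rcases le_total (lam s) (lam t) with h1 | h1 <;> rcases le_total (lam t) (lam r) with h2 | h2 <;>
      rcases le_total (lam s) (lam r) with h3 | h3
    all_goals first
      | exact ⟨1, by simp only [Equiv.Perm.coe_one, id]; tauto⟩
      | exact ⟨Equiv.swap s t, by
          simp only [Equiv.swap_apply_left, Equiv.swap_apply_right, e1]; tauto⟩
      | exact ⟨Equiv.swap s r, by
          simp only [Equiv.swap_apply_left, Equiv.swap_apply_right, e2]; tauto⟩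
  obtain ⟨π, hπ⟩ := hπ
  obtain ⟨z, hz, hzz⟩ := exists_z _ _ _ hπ
  obtain ⟨R, hR, c, hc⟩ := scalar_compress_sorted hst (Ne.symm hrs) (Ne.symm hrt)
    (fun j => lam (π j)) z hz hzz
  obtain ⟨P, hP, hPd⟩ := perm_conj π
  refine ⟨Rᴴ * P, mul_mem (Unitary.star_mem hR) hP, c, ?_⟩
  rw [← hc, conjTranspose_mul, conjTranspose_conjTranspose]
  have := hPd fun j => (lam j : ℂ)
  have e : ((fun j => (lam j : ℂ)) ∘ π) = fun j => (lam (π j) : ℂ) := rfl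
  rw [e] at this
  rw [← this]
  simp only [Matrix.mul_assoc]

lemma exists_herm_rep {n : ℕ} (l : Matrix (Fin n) (Fin n) ℂ →ₗ[ℝ] ℝ) :
    ∃ C : Matrix (Fin n) (Fin n) ℂ, C.IsHermitian ∧
      ∀ X : Matrix (Fin n) (Fin n) ℂ, X.IsHermitian → l X = (C * X).trace.re := by
  let C : Matrix (Fin n) (Fin n) ℂ := Matrix.of fun j k =>
    ((l (Matrix.single k j 1) : ℝ) : ℂ) - Complex.I * (l (Matrix.single k j Complex.I) : ℝ)
  have hC : ∀ X : Matrix (Fin n) (Fin n) ℂ, l X = (C * X).trace.re := by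
    intro X
    have hs : ∀ k j, l (Matrix.single k j (X k j)) =
        (X k j).re * l (Matrix.single k j 1) + (X k j).im * l (Matrix.single k j Complex.I) := by
      intro k j
      have : Matrix.single k j (X k j) = (X k j).re • Matrix.single k j (1 : ℂ) +
          (X k j).im • Matrix.single k j Complex.I := by
        rw [Matrix.smul_single, Matrix.smul_single, ← Matrix.single_add]
        congr 1
        conv_lhs => rw [← Complex.re_add_im (X k j)]
        simp
      rw [this, map_add, map_smul, map_smul, smul_eq_mul, smul_eq_mul]
    conv_lhs => rw [Matrix.matrix_eq_sum_single X]
    simp only [map_sum, hs, Matrix.trace, Matrix.diag, Matrix.mul_apply, Complex.re_sum]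
    rw [Finset.sum_comm]
    refine Finset.sum_congr rfl fun j _ => Finset.sum_congr rfl fun k _ => ?_
    simp [C]
    ring
  refine ⟨(1 / 2 : ℂ) • (C + Cᴴ), ?_, ?_⟩
  · rw [IsHermitian, conjTranspose_smul, conjTranspose_add, conjTranspose_conjTranspose, add_comm]
    simp
  · intro X hX
    have : (Cᴴ * X).trace = star (C * X).trace := by
      rw [← trace_conjTranspose, conjTranspose_mul, hX.eq, trace_mul_comm]
    rw [hC, Matrix.smul_mul, Matrix.add_mul, trace_smul, trace_add, this]
    simp
    ring

lemma exists_degenerate {n : ℕ} (hn : 2 < n) {s t : Fin n} (hst : s ≠ t)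
    (l : Matrix (Fin n) (Fin n) ℂ →ₗ[ℝ] ℝ) :
    ∃ V ∈ unitaryGroup (Fin n) ℂ, ∀ x, l (Vᴴ * (Jmat s t * Nmat x * (Jmat s t)ᴴ) * V) = 0 := by
  obtain ⟨C, hC, hl⟩ := exists_herm_rep l
  obtain ⟨Y, hY, c, hc⟩ := scalar_compress hn hst hC.eigenvalues
  let Q : Matrix (Fin n) (Fin n) ℂ := hC.eigenvectorUnitary
  have hQ : Q ∈ unitaryGroup (Fin n) ℂ := hC.eigenvectorUnitary.2
  have hCQ : C = Q * (Matrix.diagonal fun j => (hC.eigenvalues j : ℂ)) * Qᴴ := by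
    have := hC.spectral_theorem
    rw [Unitary.conjStarAlgAut_apply] at this
    exact this
  have hQQ : Qᴴ * Q = 1 := mem_unitaryGroup_iff'.1 hQ
  refine ⟨Y * Qᴴ, mul_mem hY (Unitary.star_mem hQ), fun x => ?_⟩
  have hH : ((Y * Qᴴ)ᴴ * (Jmat s t * Nmat x * (Jmat s t)ᴴ) * (Y * Qᴴ)).IsHermitian := by
    simp [IsHermitian, conjTranspose_mul, Nmat_herm, Matrix.mul_assoc]
  rw [hl _ hH]
  have e : (C * ((Y * Qᴴ)ᴴ * (Jmat s t * Nmat x * (Jmat s t)ᴴ) * (Y * Qᴴ))).trace =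
      ((Jmat s t)ᴴ * (Y * (Matrix.diagonal fun j => (hC.eigenvalues j : ℂ)) * Yᴴ) * Jmat s t
        * Nmat x).trace := by
    have e1 : C * ((Y * Qᴴ)ᴴ * (Jmat s t * Nmat x * (Jmat s t)ᴴ) * (Y * Qᴴ)) =
        (Q * (Matrix.diagonal fun j => (hC.eigenvalues j : ℂ)) * (Qᴴ * Q) * Yᴴ * Jmat s t * Nmat x) *
          ((Jmat s t)ᴴ * Y * Qᴴ) := by
      conv_lhs => rw [hCQ]
      simp only [conjTranspose_mul, conjTranspose_conjTranspose, Matrix.mul_assoc]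
    rw [e1, trace_mul_comm, hQQ]
    have e2 : (Jmat s t)ᴴ * Y * Qᴴ * (Q * (Matrix.diagonal fun j => (hC.eigenvalues j : ℂ)) * 1 *
        Yᴴ * Jmat s t * Nmat x) = (Jmat s t)ᴴ * Y * (Qᴴ * Q) *
        ((Matrix.diagonal fun j => (hC.eigenvalues j : ℂ)) * Yᴴ * Jmat s t * Nmat x) := by
      simp only [Matrix.mul_assoc, Matrix.one_mul]
    rw [e2, hQQ]
    simp only [Matrix.mul_assoc, Matrix.one_mul]
  rw [e, hc]
  simp [Nmat, trace_fin_two]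

lemma single_pinch {n m : ℕ} (hn : 2 < n) (P : Matrix (Fin n) (Fin n) ℝ) (hP : IsPinching P)
    (d : Fin m → Fin n → ℝ)
    (L : (Fin m → Matrix (Fin n) (Fin n) ℂ) →ₗ[ℝ] (Fin 3 → ℝ)) :
    ∃ V ∈ unitaryGroup (Fin n) ℂ,
      L (fun i => Matrix.diagonal fun j => ((P *ᵥ d i) j : ℂ)) =
        L fun i => Vᴴ * (Matrix.diagonal fun j => (d i j : ℂ)) * V := by
  obtain ⟨s, t, hlt, α, hα, hPe⟩ := hP
  have hst : s ≠ t := hlt.ne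
  let δ : Fin m → ℂ := fun i => (((d i s - d i t) / 2 : ℝ) : ℂ)
  -- the linear part
  let G : Matrix (Fin n) (Fin n) ℂ →ₗ[ℝ] (Fin 3 → ℝ) :=
    { toFun := fun X => L fun i => δ i • X
      map_add' := fun X Y => by
        rw [← map_add]; congr 1; funext i; simp
      map_smul' := fun c X => by
        rw [RingHom.id_apply, ← map_smul]; congr 1; funext i; simp [smul_comm c] }
  let l : Matrix (Fin n) (Fin n) ℂ →ₗ[ℝ] ℝ := LinearMap.proj 0 ∘ₗ G
  obtain ⟨V, hV, hVl⟩ := exists_degenerate hn hst l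
  obtain ⟨z, hz, γ, hγ, hγu, hγ0, hγ1⟩ := unitary_path V hV
  let K : (Fin 3 → ℝ) →ₗ[ℝ] Matrix (Fin n) (Fin n) ℂ :=
    { toFun := fun x => Jmat s t * NmatL x * (Jmat s t)ᴴ
      map_add' := fun x y => by rw [map_add, Matrix.mul_add, Matrix.add_mul]
      map_smul' := fun c x => by
        rw [map_smul, Matrix.mul_smul, Matrix.smul_mul, RingHom.id_apply] }
  have hK : ∀ x, K x = Jmat s t * Nmat x * (Jmat s t)ᴴ := fun x => rfl
  let A : unitInterval → (Fin 3 → ℝ) →ₗ[ℝ] (Fin 3 → ℝ) := fun τ =>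
    { toFun := fun x => G ((γ τ)ᴴ * K x * γ τ)
      map_add' := fun x y => by rw [map_add, Matrix.mul_add, Matrix.add_mul, map_add]
      map_smul' := fun c x => by
        rw [map_smul, Matrix.mul_smul, Matrix.smul_mul, map_smul, RingHom.id_apply] }
  let q : unitInterval → Fin 3 → ℝ := fun τ => L fun i => (γ τ)ᴴ * Tmat s t (d i) * γ τ
  have hLc : Continuous L := LinearMap.continuous_of_finiteDimensional L
  have hGc : Continuous G := LinearMap.continuous_of_finiteDimensional G
  have hqM : ∀ τ x, q τ + LinearMap.toMatrix' (A τ) *ᵥ x =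
      L fun i => (γ τ)ᴴ * (Tmat s t (d i) + δ i • (Jmat s t * Nmat x * (Jmat s t)ᴴ)) * γ τ := by
    intro τ x
    rw [LinearMap.toMatrix'_mulVec]
    change L _ + L _ = _
    rw [← map_add]
    congr 1
    funext i
    simp [Matrix.mul_add, Matrix.add_mul, hK]
  have hq : Continuous q := by
    refine hLc.comp (continuous_pi fun i => ?_)
    exact (hγ.matrix_conjTranspose.matrix_mul continuous_const).matrix_mul hγ
  have hM : Continuous fun τ => LinearMap.toMatrix' (A τ) := by
    refine continuous_matrix fun i j => ?_
    simp only [LinearMap.toMatrix'_apply]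
    refine (continuous_apply i).comp (hGc.comp ?_)
    exact (hγ.matrix_conjTranspose.matrix_mul continuous_const).matrix_mul hγ
  have hdet : (LinearMap.toMatrix' (A 1)).det = 0 := by
    refine Matrix.det_eq_zero_of_row_eq_zero 0 fun j => ?_
    rw [LinearMap.toMatrix'_apply]
    change l ((γ 1)ᴴ * K _ * γ 1) = 0
    rw [hγ1, conjTranspose_smul, Matrix.smul_mul, Matrix.smul_mul, Matrix.mul_smul, smul_smul, hz,
      one_smul]
    exact hVl _
  obtain ⟨τ, x, hx, hτ⟩ := core_top q (fun τ => LinearMap.toMatrix' (A τ)) hq hM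
    (L (fun i => Matrix.diagonal fun j => ((P *ᵥ d i) j : ℂ))) ![0, 0, 2 * α - 1]
    (by
      simp only [dotProduct, Fin.sum_univ_three]
      simp
      nlinarith [hα.1, hα.2])
    (by
      rw [hqM, hγ0]
      congr 1
      funext i
      rw [pinch_eq hst α P hPe]
      simp [δ])
    hdet
  obtain ⟨R, hR, hRd⟩ := diag_rotate hst x hx
  refine ⟨R * γ τ, mul_mem hR (hγu τ), ?_⟩
  rw [← hτ, hqM]
  congr 1
  funext i
  rw [← hRd (d i), conjTranspose_mul]
  simp only [Matrix.mul_assoc]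

lemma range_pinch {n m : ℕ} (hn : 2 < n) (P : Matrix (Fin n) (Fin n) ℝ) (hP : IsPinching P)
    (d : Fin m → Fin n → ℝ)
    (L : (Fin m → Matrix (Fin n) (Fin n) ℂ) →ₗ[ℝ] (Fin 3 → ℝ)) :
    LNumericalRange L (fun i => Matrix.diagonal fun j => ((P *ᵥ d i) j : ℂ)) ⊆
      LNumericalRange L (fun i => Matrix.diagonal fun j => (d i j : ℂ)) := by
  rintro y ⟨U, hU, rfl⟩
  let L' : (Fin m → Matrix (Fin n) (Fin n) ℂ) →ₗ[ℝ] (Fin 3 → ℝ) :=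
    { toFun := fun X => L fun i => Uᴴ * X i * U
      map_add' := fun X Y => by
        rw [← map_add]; congr 1; funext i; simp [Matrix.mul_add, Matrix.add_mul]
      map_smul' := fun c X => by
        rw [RingHom.id_apply, ← map_smul]; congr 1; funext i; simp }
  obtain ⟨V, hV, h⟩ := single_pinch hn P hP d L'
  refine ⟨V * U, mul_mem hV hU, ?_⟩
  change L' _ = _
  rw [h]
  change L _ = _
  congr 1
  funext i
  simp only [conjTranspose_mul, Matrix.mul_assoc]

/-- If `n > 2` and `D̂ ≺ D`, then `W_L(D̂) ⊆ W_L(D)` for every linear `L : H_n^m → ℝ³`. -/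
theorem stmt4 {n m : ℕ} (hn : 2 < n) (d dhat : Fin m → Fin n → ℝ)
    (hprec : PinchPrec dhat d)
    (L : (Fin m → Matrix (Fin n) (Fin n) ℂ) →ₗ[ℝ] (Fin 3 → ℝ)) :
    LNumericalRange L (fun i => Matrix.diagonal fun j => (dhat i j : ℂ)) ⊆
      LNumericalRange L (fun i => Matrix.diagonal fun j => (d i j : ℂ)) := by
  obtain ⟨Ps, hPs, hd⟩ := hprec
  obtain rfl : dhat = fun i => Ps.prod *ᵥ d i := funext hd
  clear hd
  induction Ps with
  | nil => simp
  | cons P Ps ih =>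
    have h1 := range_pinch hn P (hPs P (by simp)) (fun i => Ps.prod *ᵥ d i) L
    have h2 := ih fun Q hQ => hPs Q (by simp [hQ])
    simp only [List.prod_cons, ← mulVec_mulVec]
    exact h1.trans h2
end

section
/- Let n > 2 and let D = (D₁,...,D_m) be an m-tuple of n×n real diagonal matrices (viewed as Hermitian matrices). Then for every linear map L : (H_n)^m → ℝ³, the L-numerical range W_L(D) is star-shaped with star-center L((tr D₁/n)·I_n, ..., (tr D_m/n)·I_n); that is, this point lies in W_L(D) and for every x ∈ W_L(D) and every α ∈ [0,1], the point α·x + (1−α)·L((tr D₁/n)·I_n, ..., (tr D_m/n)·I_n) lies in W_L(D). -/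
open Matrix

lemma fill_lemma {X : Type*} [TopologicalSpace X] [PreconnectedSpace X]
    (c : X → Fin 3 → ℝ) (T : X → Matrix (Fin 3) (Fin 3) ℝ) (hc : Continuous c)
    (hT : Continuous T) (p : Fin 3 → ℝ) (x0 : X) (y0 : Fin 3 → ℝ)
    (h0 : c x0 + T x0 *ᵥ y0 = p) (hy0 : y0 ⬝ᵥ y0 ≤ 1) (x1 : X) (h1 : (T x1).det = 0) :
    ∃ x y, y ⬝ᵥ y = 1 ∧ c x + T x *ᵥ y = p := by
  by_contra! hno
  have hlt : ∀ x y, y ⬝ᵥ y ≤ 1 → c x + T x *ᵥ y = p → y ⬝ᵥ y < 1 := fun x y hy h =>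
    lt_of_le_of_ne hy fun h' => hno x y h' h
  have hdet : ∀ x y, y ⬝ᵥ y ≤ 1 → c x + T x *ᵥ y = p → (T x).det ≠ 0 := by
    intro x y hy h hd
    obtain ⟨k, hk, hk0⟩ := Matrix.exists_mulVec_eq_zero_iff.2 hd
    have hkk : 0 < k ⬝ᵥ k := by
      rcases (show (0:ℝ) ≤ k ⬝ᵥ k from Finset.sum_nonneg fun i _ => mul_self_nonneg _).lt_or_eq
        with h | h
      · exact h
      · exact absurd (dotProduct_self_eq_zero.1 h.symm) hk
    have key : ∀ t : ℝ, (y + t • k) ⬝ᵥ (y + t • k) = y ⬝ᵥ y + 2 * t * (y ⬝ᵥ k) + t ^ 2 * (k ⬝ᵥ k) := by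
      intro t
      simp only [dotProduct, Fin.sum_univ_three, Pi.add_apply, Pi.smul_apply, smul_eq_mul]
      ring
    have hdisc : 0 ≤ (y ⬝ᵥ k) ^ 2 + (k ⬝ᵥ k) * (1 - y ⬝ᵥ y) := by
      have := mul_nonneg hkk.le (sub_nonneg.2 hy)
      positivity
    refine hno x (y + ((- (y ⬝ᵥ k) + Real.sqrt ((y ⬝ᵥ k) ^ 2 + (k ⬝ᵥ k) * (1 - y ⬝ᵥ y))) / (k ⬝ᵥ k)) • k)
      ?_ ?_
    · rw [key]
      have := Real.sq_sqrt hdisc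
      set r := Real.sqrt ((y ⬝ᵥ k) ^ 2 + (k ⬝ᵥ k) * (1 - y ⬝ᵥ y))
      field_simp
      nlinarith
    · rw [mulVec_add, mulVec_smul, hk0, smul_zero, add_zero, h]
  let S : Set X := {x | ∃ y : Fin 3 → ℝ, y ⬝ᵥ y ≤ 1 ∧ c x + T x *ᵥ y = p}
  have hdotc : Continuous fun y : Fin 3 → ℝ => y ⬝ᵥ y := by
    simp only [dotProduct]; fun_prop
  have hK : IsCompact {y : Fin 3 → ℝ | y ⬝ᵥ y ≤ 1} := by
    refine (isCompact_closedBall (0 : Fin 3 → ℝ) 1).of_isClosed_subset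
      (isClosed_le hdotc continuous_const) ?_
    intro y hy
    rw [mem_closedBall_zero_iff, pi_norm_le_iff_of_nonneg zero_le_one]
    intro i
    have : y i * y i ≤ y ⬝ᵥ y :=
      Finset.single_le_sum (f := fun i => y i * y i) (fun i _ => mul_self_nonneg _) (Finset.mem_univ i)
    rw [Real.norm_eq_abs, abs_le]
    have hy' : y ⬝ᵥ y ≤ 1 := hy
    constructor <;> nlinarith
  have hclosed : IsClosed S := by
    have : CompactSpace {y : Fin 3 → ℝ | y ⬝ᵥ y ≤ 1} := isCompact_iff_compactSpace.1 hK
    have hcl : IsClosed {z : X × {y : Fin 3 → ℝ | y ⬝ᵥ y ≤ 1} | c z.1 + T z.1 *ᵥ (z.2 : Fin 3 → ℝ) = p} := by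
      refine isClosed_eq ?_ continuous_const
      exact (hc.comp continuous_fst).add
        ((hT.comp continuous_fst).matrix_mulVec (continuous_subtype_val.comp continuous_snd))
    have := isClosedMap_fst_of_compactSpace _ hcl
    convert this using 1
    ext x
    simp [S]
  have hopen : IsOpen S := by
    rw [isOpen_iff_mem_nhds]
    rintro x ⟨y, hy, h⟩
    have hd := hdet x y hy h
    let Y : X → Fin 3 → ℝ := fun x => ((T x).det)⁻¹ • ((T x).adjugate *ᵥ (p - c x))
    have hY : ContinuousAt Y x := by
      refine ContinuousAt.smul (ContinuousAt.inv₀ hT.matrix_det.continuousAt hd) ?_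
      exact (hT.matrix_adjugate.matrix_mulVec (continuous_const.sub hc)).continuousAt
    have hYx : Y x = y := by
      simp only [Y]
      rw [← h, add_sub_cancel_left, mulVec_mulVec, adjugate_mul, smul_mulVec, one_mulVec, smul_smul,
        inv_mul_cancel₀ hd, one_smul]
    have e1 : ∀ᶠ x' in nhds x, (Y x') ⬝ᵥ (Y x') < 1 := by
      have : ContinuousAt (fun x' => (Y x') ⬝ᵥ (Y x')) x :=
        ContinuousAt.comp (f := Y) hdotc.continuousAt hY
      refine this.eventually_lt continuousAt_const ?_
      rw [hYx]; exact hlt x y hy h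
    have e2 : ∀ᶠ x' in nhds x, (T x').det ≠ 0 := hT.matrix_det.continuousAt.eventually_ne hd
    filter_upwards [e1, e2] with x' h1 h2
    refine ⟨Y x', h1.le, ?_⟩
    simp only [Y]
    rw [mulVec_smul, mulVec_mulVec, mul_adjugate, smul_mulVec, one_mulVec, smul_smul,
        inv_mul_cancel₀ h2, one_smul, add_sub_cancel]
  have huniv : S = Set.univ := IsClopen.eq_univ ⟨hclosed, hopen⟩ ⟨x0, y0, hy0, h0⟩
  obtain ⟨y, hy, h⟩ : x1 ∈ S := huniv ▸ Set.mem_univ _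
  exact hdet x1 y hy h h1

noncomputable def rotG {n : ℕ} (j k : Fin n) (a b : ℂ) : Matrix (Fin n) (Fin n) ℂ :=
  1 + (single j j (a - 1) + single j k b - single k j (star b) + single k k (star a - 1))

lemma rotG_conjTranspose {n : ℕ} (j k : Fin n) (a b : ℂ) :
    (rotG j k a b)ᴴ =
      1 + (single j j (star a - 1) + single k j (star b) - single j k b + single k k (a - 1)) := by
  simp [rotG, conjTranspose_add, conjTranspose_sub, conjTranspose_single]

lemma rotG_mem {n : ℕ} {j k : Fin n} (hjk : j ≠ k) {a b : ℂ} (h : a * star a + b * star b = 1) :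
    rotG j k a b ∈ unitaryGroup (Fin n) ℂ := by
  rw [mem_unitaryGroup_iff, star_eq_conjTranspose, rotG_conjTranspose, rotG]
  simp only [mul_add, add_mul, sub_mul, mul_sub, one_mul, mul_one, single_mul_single_same,
    single_mul_single_of_ne _ _ _ _ hjk, single_mul_single_of_ne _ _ _ _ hjk.symm]
  ext p q
  simp only [Matrix.add_apply, Matrix.sub_apply, Matrix.zero_apply, single_apply]
  by_cases h1 : j = p <;> by_cases h2 : k = p <;> by_cases h3 : j = q <;> by_cases h4 : k = q <;> simp_all <;> grind

/-- The Bloch matrices. -/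
noncomputable def blochM {n : ℕ} (j k : Fin n) : Fin 3 → Matrix (Fin n) (Fin n) ℂ :=
  ![single j k 1 + single k j 1, single j k Complex.I - single k j Complex.I,
    single j j 1 - single k k 1]

lemma bloch_exists (y : Fin 3 → ℝ) (hy : y ⬝ᵥ y = 1) :
    ∃ a b : ℂ, a * star a + b * star b = 1 ∧ a * star a - b * star b = y 2 ∧
      2 * star a * b = y 0 + y 1 * Complex.I := by
  simp only [dotProduct, Fin.sum_univ_three] at hy
  have h2 : y 2 ≤ 1 ∧ -1 ≤ y 2 := by constructor <;> nlinarith [sq_nonneg (y 0), sq_nonneg (y 1)]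
  by_cases h : y 2 = -1
  · have h0 : y 0 = 0 := by rw [h] at hy; nlinarith [sq_nonneg (y 0), sq_nonneg (y 1)]
    have h1 : y 1 = 0 := by rw [h] at hy; nlinarith [sq_nonneg (y 0), sq_nonneg (y 1)]
    exact ⟨0, 1, by simp, by simp [h], by simp [h0, h1]⟩
  · have hpos : 0 < (1 + y 2) / 2 := by
      have : -1 < y 2 := lt_of_le_of_ne h2.2 (Ne.symm h)
      linarith
    set r := Real.sqrt ((1 + y 2) / 2) with hr
    have hr0 : 0 < r := Real.sqrt_pos.2 hpos
    have hr2 : r ^ 2 = (1 + y 2) / 2 := Real.sq_sqrt hpos.le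
    have hrc : (r : ℂ) ≠ 0 := by exact_mod_cast hr0.ne'
    have hr2c : (r : ℂ) ^ 2 = (1 + y 2) / 2 := by exact_mod_cast hr2
    have hyc : (y 0 * y 0 + y 1 * y 1 + y 2 * y 2 : ℂ) = 1 := by exact_mod_cast hy
    have hb : (y 0 + y 1 * Complex.I : ℂ) / (2 * r) * star ((y 0 + y 1 * Complex.I : ℂ) / (2 * r))
        = (1 - y 2) / 2 := by
      have hI := Complex.I_sq
      simp only [Complex.star_def, map_div₀, map_add, map_mul, Complex.conj_ofReal, Complex.conj_I,
        map_ofNat]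
      field_simp
      linear_combination hyc - 2 * (1 - (y 2 : ℂ)) * hr2c - (y 1 : ℂ)^2 * hI
    refine ⟨r, (y 0 + y 1 * Complex.I) / (2 * r), ?_, ?_, ?_⟩
    · rw [hb, Complex.star_def, Complex.conj_ofReal]; linear_combination hr2c
    · rw [hb, Complex.star_def, Complex.conj_ofReal]; linear_combination hr2c
    · rw [Complex.star_def, Complex.conj_ofReal]; field_simp

noncomputable def midD {n : ℕ} (j k : Fin n) (d : Fin n → ℝ) : Matrix (Fin n) (Fin n) ℂ :=
  diagonal (fun q => (((d q + d (Equiv.swap j k q)) / 2 : ℝ) : ℂ))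

lemma rot_diag {n : ℕ} {j k : Fin n} (hjk : j ≠ k) (y : Fin 3 → ℝ) {a b : ℂ}
    (h1 : a * star a + b * star b = 1) (h2 : a * star a - b * star b = y 2)
    (h3 : 2 * star a * b = y 0 + y 1 * Complex.I) (d : Fin n → ℝ) :
    (rotG j k a b)ᴴ * diagonal (fun q => (d q : ℂ)) * rotG j k a b =
      midD j k d + ∑ s, ((d j - d k) / 2 * y s) • blochM j k s := by
  have h4 : 2 * a * star b = y 0 - y 1 * Complex.I := by
    have := congrArg star h3
    simpa [mul_comm, mul_left_comm, mul_assoc, sub_eq_add_neg] using this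
  simp only [Complex.star_def] at h1 h2 h3 h4
  rw [rotG_conjTranspose, rotG]
  have ea : ∀ (x : Fin n) (p q : Fin n) (z : ℂ), single p q z * diagonal (fun q => (d q : ℂ)) = single p q (z * d q) := by
    intro x p q z; ext i j; simp [mul_diagonal, single_apply]; grind
  have eb : ∀ (p q : Fin n) (z : ℂ), diagonal (fun q => (d q : ℂ)) * single p q z = single p q (d p * z) := by
    intro p q z; ext i j; simp [diagonal_mul, single_apply]; grind
  simp only [mul_add, add_mul, sub_mul, mul_sub, one_mul, mul_one, ea j, eb, single_mul_single_same,
    single_mul_single_of_ne _ _ _ _ hjk, single_mul_single_of_ne _ _ _ _ hjk.symm]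
  ext p q
  simp only [midD, blochM, Fin.sum_univ_three, Matrix.add_apply, Matrix.sub_apply, Matrix.zero_apply, Matrix.smul_apply,
    cons_val_zero, cons_val_one, cons_val, single_apply, diagonal_apply, Complex.real_smul]
  by_cases e1 : j = p
  · subst e1
    by_cases e3 : j = q
    · subst e3
      simp [hjk.symm]
      linear_combination ((d j : ℂ) + d k) / 2 * h1 + ((d j : ℂ) - d k) / 2 * h2
    · by_cases e4 : k = q
      · subst e4
        simp [hjk, hjk.symm]
        linear_combination ((d j : ℂ) - d k) / 2 * h3
      · simp [e3, e4]
  · by_cases e2 : k = p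
    · subst e2
      by_cases e3 : j = q
      · subst e3
        simp [hjk, hjk.symm]
        linear_combination ((d j : ℂ) - d k) / 2 * h4
      · by_cases e4 : k = q
        · subst e4
          simp [hjk, hjk.symm]
          linear_combination ((d j : ℂ) + d k) / 2 * h1 - ((d j : ℂ) - d k) / 2 * h2
        · simp [e3, e4]
    · simp [e1, e2, Equiv.swap_apply_of_ne_of_ne (Ne.symm e1) (Ne.symm e2)]


/-- permutation operator -/
noncomputable def permOp {n : ℕ} (e : Equiv.Perm (Fin n)) : (Fin n → ℝ) →L[ℝ] (Fin n → ℝ) :=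
  ContinuousLinearMap.pi fun q => ContinuousLinearMap.proj (e q)

/-- averaging operator -/
noncomputable def avgOp (n : ℕ) : (Fin n → ℝ) →L[ℝ] (Fin n → ℝ) :=
  ContinuousLinearMap.pi fun _ => (n : ℝ)⁻¹ • ∑ r, ContinuousLinearMap.proj r

lemma permOp_norm {n : ℕ} (e : Equiv.Perm (Fin n)) : ‖permOp e‖ ≤ 1 := by
  refine ContinuousLinearMap.opNorm_le_bound _ zero_le_one fun f => ?_
  rw [one_mul, pi_norm_le_iff_of_nonneg (norm_nonneg _)]
  intro q
  exact norm_le_pi_norm f (e q)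

lemma avgOp_apply {n : ℕ} (f : Fin n → ℝ) (q : Fin n) :
    avgOp n f q = (n : ℝ)⁻¹ * ∑ r, f r := by
  simp [avgOp]

lemma avgOp_norm {n : ℕ} (hn : 0 < n) : ‖avgOp n‖ ≤ 1 := by
  refine ContinuousLinearMap.opNorm_le_bound _ zero_le_one fun f => ?_
  rw [one_mul, pi_norm_le_iff_of_nonneg (norm_nonneg _)]
  intro q
  have hn' : (0:ℝ) < n := by exact_mod_cast hn
  rw [avgOp_apply, norm_mul, norm_inv, Real.norm_natCast, inv_mul_le_iff₀ hn']
  refine (norm_sum_le _ _).trans ?_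
  refine (Finset.sum_le_sum fun r _ => norm_le_pi_norm f r).trans ?_
  simp

lemma avgOp_sq {n : ℕ} (hn : 0 < n) : avgOp n * avgOp n = avgOp n := by
  ext f q
  have hn' : (n:ℝ) ≠ 0 := by exact_mod_cast hn.ne'
  rw [mul_apply_eq_comp]
  simp only [avgOp_apply]
  simp [hn']

lemma one_norm_le {n : ℕ} : ‖(1 : (Fin n → ℝ) →L[ℝ] (Fin n → ℝ))‖ ≤ 1 :=
  ContinuousLinearMap.norm_id_le

lemma mix_norm {n : ℕ} (M : (Fin n → ℝ) →L[ℝ] (Fin n → ℝ)) (hM : ‖M‖ ≤ 1) (s : ℝ)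
    (h0 : 0 ≤ s) (h1 : s ≤ 1) : ‖(1 - s) • (1 : (Fin n → ℝ) →L[ℝ] (Fin n → ℝ)) + s • M‖ ≤ 1 := by
  refine (norm_add_le _ _).trans ?_
  rw [norm_smul, norm_smul, Real.norm_of_nonneg h0, Real.norm_of_nonneg (sub_nonneg.2 h1)]
  nlinarith [one_norm_le (n := n)]

lemma sum_swap {n : ℕ} (hn : 0 < n) :
    ∑ z : Fin n × Fin n, (permOp (Equiv.swap z.1 z.2) - 1) = (2 * n : ℝ) • (avgOp n - 1) := by
  ext f q
  have hn' : (n:ℝ) ≠ 0 := by exact_mod_cast hn.ne'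
  have key : ∀ z : Fin n × Fin n, f (Equiv.swap z.1 z.2 q) - f q =
      (if z.1 = q then f z.2 - f q else 0) + (if z.2 = q then f z.1 - f q else 0) := by
    rintro ⟨j, k⟩
    by_cases h1 : j = q
    · subst h1
      by_cases h2 : k = j
      · subst h2; simp
      · simp [h2]
    · by_cases h2 : k = q
      · subst h2; simp [h1]
      · simp [h1, h2, Equiv.swap_apply_of_ne_of_ne (Ne.symm h1) (Ne.symm h2)]
  have : (∑ z : Fin n × Fin n, (permOp (Equiv.swap z.1 z.2) - 1)) f q
      = ∑ z : Fin n × Fin n, (f (Equiv.swap z.1 z.2 q) - f q) := by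
    simp [permOp]
    ring
  rw [this, Finset.sum_congr rfl fun z _ => key z, Finset.sum_add_distrib, Fintype.sum_prod_type,
    Fintype.sum_prod_type_right]
  simp [avgOp_apply]
  field_simp
  ring

lemma prod_approx {R : Type*} [NormedRing R] [NormedAlgebra ℝ R] (l : List R) :
    ∃ C : ℝ, 0 ≤ C ∧ ∀ s : ℝ, 0 ≤ s → s ≤ 1 →
      ‖(l.map fun X => 1 + s • X).prod - (1 + s • l.sum)‖ ≤ C * s ^ 2 := by
  induction l with
  | nil => exact ⟨0, le_rfl, fun s _ _ => by simp⟩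
  | cons X l ih =>
    obtain ⟨C, hC, h⟩ := ih
    refine ⟨(C + ‖X‖ * C) + ‖X * l.sum‖, by positivity, fun s h0 h1 => ?_⟩
    have e : ((X :: l).map fun X => 1 + s • X).prod - (1 + s • (X :: l).sum)
        = ((l.map fun X => 1 + s • X).prod - (1 + s • l.sum)) +
          s • (X * ((l.map fun X => 1 + s • X).prod - (1 + s • l.sum))) + s ^ 2 • (X * l.sum) := by
      simp only [List.map_cons, List.prod_cons, List.sum_cons, add_mul, one_mul, smul_mul_assoc,
        mul_sub, mul_add, mul_one, mul_smul_comm, smul_sub, smul_add, smul_smul, pow_two]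
      abel
    rw [e]
    set Y := (l.map fun X => 1 + s • X).prod - (1 + s • l.sum)
    have hY := h s h0 h1
    have a1 : ‖s • (X * Y)‖ ≤ ‖X‖ * C * s ^ 2 := by
      rw [norm_smul, Real.norm_of_nonneg h0]
      calc s * ‖X * Y‖ ≤ 1 * (‖X‖ * ‖Y‖) :=
            mul_le_mul h1 (norm_mul_le _ _) (norm_nonneg _) zero_le_one
        _ ≤ ‖X‖ * (C * s ^ 2) := by rw [one_mul]; gcongr
        _ = _ := by ring
    have a2 : ‖s ^ 2 • (X * l.sum)‖ = ‖X * l.sum‖ * s ^ 2 := by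
      rw [norm_smul, Real.norm_of_nonneg (by positivity), mul_comm]
    calc _ ≤ ‖Y‖ + ‖s • (X * Y)‖ + ‖s ^ 2 • (X * l.sum)‖ := norm_add₃_le
      _ ≤ _ := by rw [a2]; nlinarith

lemma pow_norm_le {R : Type*} [NormedRing R] (A : R) (hA : ‖A‖ ≤ 1) (h1 : ‖(1 : R)‖ ≤ 1) (N : ℕ) :
    ‖A ^ N‖ ≤ 1 := by
  induction N with
  | zero => simpa using h1
  | succ N ih =>
    rw [pow_succ]
    exact (norm_mul_le _ _).trans (mul_le_one₀ ih (norm_nonneg _) hA)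

lemma pow_diff {R : Type*} [NormedRing R] (A B : R) (hA : ‖A‖ ≤ 1) (hB : ‖B‖ ≤ 1)
    (h1 : ‖(1 : R)‖ ≤ 1) (N : ℕ) : ‖A ^ N - B ^ N‖ ≤ N * ‖A - B‖ := by
  induction N with
  | zero => simp
  | succ N ih =>
    have e : A ^ (N + 1) - B ^ (N + 1) = A ^ N * (A - B) + (A ^ N - B ^ N) * B := by
      rw [pow_succ, pow_succ]; noncomm_ring
    rw [e]
    have b1 := norm_mul_le (A ^ N) (A - B)
    have b2 := norm_mul_le (A ^ N - B ^ N) B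
    have b3 := pow_norm_le A hA h1 N
    have b4 := norm_add_le (A ^ N * (A - B)) ((A ^ N - B ^ N) * B)
    push_cast
    nlinarith [norm_nonneg (A - B), norm_nonneg (A ^ N - B ^ N), norm_nonneg B, norm_nonneg (A ^ N)]

lemma list_prod_norm {R : Type*} [NormedRing R] (h1 : ‖(1 : R)‖ ≤ 1) (l : List R)
    (h : ∀ x ∈ l, ‖x‖ ≤ 1) : ‖l.prod‖ ≤ 1 := by
  induction l with
  | nil => simpa using h1
  | cons x l ih =>
    rw [List.prod_cons]
    exact (norm_mul_le _ _).trans (mul_le_one₀ (h x (by simp)) (norm_nonneg _)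
      (ih fun y hy => h y (by simp [hy])))

lemma mix_pow {n : ℕ} (hn : 0 < n) (β : ℝ) (N : ℕ) :
    (β • (1 : (Fin n → ℝ) →L[ℝ] (Fin n → ℝ)) + (1 - β) • avgOp n) ^ N =
      β ^ N • (1 : (Fin n → ℝ) →L[ℝ] (Fin n → ℝ)) + (1 - β ^ N) • avgOp n := by
  induction N with
  | zero => simp
  | succ N ih =>
    rw [pow_succ, ih]
    simp only [mul_add, add_mul, smul_mul_assoc, mul_smul_comm, one_mul, mul_one, avgOp_sq hn]
    module

open Filter Topology in
lemma semigroup_mem {n : ℕ} (hn : 0 < n) (K : Set ((Fin n → ℝ) →L[ℝ] (Fin n → ℝ)))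
    (hcl : IsClosed K) (hone : 1 ∈ K) (hmul : ∀ A ∈ K, ∀ B ∈ K, A * B ∈ K)
    (hsw : ∀ (j k : Fin n) (s : ℝ), 0 ≤ s → s ≤ 1 →
      (1 - s) • (1 : (Fin n → ℝ) →L[ℝ] (Fin n → ℝ)) + s • permOp (Equiv.swap j k) ∈ K)
    (α : ℝ) (h0 : 0 ≤ α) (h1 : α ≤ 1) :
    α • (1 : (Fin n → ℝ) →L[ℝ] (Fin n → ℝ)) + (1 - α) • avgOp n ∈ K := by
  have hn' : (0:ℝ) < n := by exact_mod_cast hn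
  have hpow : ∀ A ∈ K, ∀ N : ℕ, A ^ N ∈ K := by
    intro A hA N
    induction N with
    | zero => simpa using hone
    | succ N ih => rw [pow_succ]; exact hmul _ ih _ hA
  have hlist : ∀ l : List ((Fin n → ℝ) →L[ℝ] (Fin n → ℝ)), (∀ x ∈ l, x ∈ K) → l.prod ∈ K := by
    intro l
    induction l with
    | nil => intro _; simpa using hone
    | cons x l ih =>
      intro h
      rw [List.prod_cons]
      exact hmul _ (h x (by simp)) _ (ih fun y hy => h y (by simp [hy]))
  -- positive case
  have hexp : ∀ t : ℝ, 0 ≤ t → Real.exp (-t) • (1 : (Fin n → ℝ) →L[ℝ] (Fin n → ℝ))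
      + (1 - Real.exp (-t)) • avgOp n ∈ K := by
    intro t ht
    let l : List ((Fin n → ℝ) →L[ℝ] (Fin n → ℝ)) :=
      (Finset.univ : Finset (Fin n × Fin n)).toList.map fun z => permOp (Equiv.swap z.1 z.2) - 1
    have hl : l.sum = (2 * n : ℝ) • (avgOp n - 1) := by
      rw [← sum_swap hn, Finset.sum_map_toList]
    obtain ⟨C, hC, hap⟩ := prod_approx l
    let A : ℝ → ((Fin n → ℝ) →L[ℝ] (Fin n → ℝ)) := fun s => (l.map fun X => 1 + s • X).prod
    have hfac : ∀ s : ℝ, 0 ≤ s → s ≤ 1 → ∀ x ∈ l.map fun X => 1 + s • X, x ∈ K ∧ ‖x‖ ≤ 1 := by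
      intro s hs0 hs1 x hx
      simp only [l, List.map_map, List.mem_map, Function.comp] at hx
      obtain ⟨z, -, rfl⟩ := hx
      have : (1 : (Fin n → ℝ) →L[ℝ] (Fin n → ℝ)) + s • (permOp (Equiv.swap z.1 z.2) - 1) =
        (1 - s) • (1 : (Fin n → ℝ) →L[ℝ] (Fin n → ℝ)) + s • permOp (Equiv.swap z.1 z.2) := by module
      rw [this]
      exact ⟨hsw _ _ s hs0 hs1, mix_norm _ (permOp_norm _) s hs0 hs1⟩
    let s : ℕ → ℝ := fun N => t / (2 * n) / N
    let B : ℕ → ((Fin n → ℝ) →L[ℝ] (Fin n → ℝ)) := fun N =>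
      (1 + -t / N) • (1 : (Fin n → ℝ) →L[ℝ] (Fin n → ℝ)) + (1 - (1 + -t / N)) • avgOp n
    have hBlim : Tendsto (fun N : ℕ => B N ^ N) atTop (𝓝 (Real.exp (-t) • (1 : (Fin n → ℝ) →L[ℝ] (Fin n → ℝ))
      + (1 - Real.exp (-t)) • avgOp n)) := by
      have := Real.tendsto_one_add_div_pow_exp (-t)
      simp only [B, mix_pow hn]
      exact (this.smul_const _).add ((tendsto_const_nhds.sub this).smul_const _)
    have hlarge : ∀ᶠ N : ℕ in atTop, 0 < N ∧ t ≤ N ∧ t / (2 * n) ≤ N := by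
      filter_upwards [eventually_gt_atTop 0, tendsto_natCast_atTop_atTop.eventually_ge_atTop t,
        tendsto_natCast_atTop_atTop.eventually_ge_atTop (t / (2 * n))] with N a b c
      exact ⟨a, b, c⟩
    have hdiff : Tendsto (fun N : ℕ => A (s N) ^ N - B N ^ N) atTop (𝓝 0) := by
      have hlim : Tendsto (fun N : ℕ => (C * (t / (2 * n)) ^ 2) / (N : ℝ)) atTop (𝓝 0) :=
        tendsto_const_div_atTop_nhds_zero_nat _
      refine squeeze_zero_norm' ?_ hlim
      filter_upwards [hlarge] with N ⟨hN, ht1, ht2⟩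
      have hN' : (0:ℝ) < N := by exact_mod_cast hN
      have hs0 : 0 ≤ s N := by positivity
      have hs1 : s N ≤ 1 := by simp only [s]; rw [div_le_one hN']; exact ht2
      have hAn : ‖A (s N)‖ ≤ 1 :=
        list_prod_norm one_norm_le _ fun x hx => (hfac _ hs0 hs1 x hx).2
      have hBn : ‖B N‖ ≤ 1 := by
        have := mix_norm _ (avgOp_norm hn) (t / N) (by positivity) (by rw [div_le_one hN']; exact ht1)
        convert this using 2
        simp only [B]
        module
      have hAB : ‖A (s N) - B N‖ ≤ C * s N ^ 2 := by
        have hB : B N = 1 + s N • l.sum := by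
          rw [hl]
          simp only [B, s]
          rw [smul_smul]
          have : t / (2 * n) / N * (2 * n) = t / N := by field_simp
          rw [this]
          module
        rw [hB]
        exact hap (s N) hs0 hs1
      refine (pow_diff _ _ hAn hBn one_norm_le N).trans ?_
      calc (N : ℝ) * ‖A (s N) - B N‖ ≤ N * (C * s N ^ 2) := by gcongr
        _ = _ := by simp only [s]; field_simp
    have hAlim := hdiff.add hBlim
    simp only [sub_add_cancel, zero_add] at hAlim
    refine hcl.mem_of_tendsto hAlim ?_
    filter_upwards [hlarge] with N ⟨hN, ht1, ht2⟩
    have hN' : (0:ℝ) < N := by exact_mod_cast hN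
    have hs0 : 0 ≤ s N := by positivity
    have hs1 : s N ≤ 1 := by simp only [s]; rw [div_le_one hN']; exact ht2
    exact hpow _ (hlist _ fun x hx => (hfac _ hs0 hs1 x hx).1) N
  rcases h0.eq_or_lt with h | h
  · subst h
    have hlim : Tendsto (fun N : ℕ => Real.exp (-(N : ℝ)) • (1 : (Fin n → ℝ) →L[ℝ] (Fin n → ℝ))
      + (1 - Real.exp (-(N : ℝ))) • avgOp n) atTop (𝓝 ((0:ℝ) • (1 : (Fin n → ℝ) →L[ℝ] (Fin n → ℝ))
      + (1 - (0:ℝ)) • avgOp n)) := by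
      have : Tendsto (fun N : ℕ => Real.exp (-(N : ℝ))) atTop (𝓝 0) :=
        Real.tendsto_exp_neg_atTop_nhds_zero.comp tendsto_natCast_atTop_atTop
      exact (this.smul_const _).add ((tendsto_const_nhds.sub this).smul_const _)
    exact hcl.mem_of_tendsto hlim (Eventually.of_forall fun N => hexp N (Nat.cast_nonneg N))
  · have := hexp (-Real.log α) (neg_nonneg.2 (Real.log_nonpos h0 h1))
    rwa [neg_neg, Real.exp_log h] at this

/-- parametrisation of the unit sphere of `ℂ²` -/
noncomputable def parA (x : ℝ × ℝ × ℝ) : ℂ := Real.cos x.1 * Complex.exp (x.2.1 * Complex.I)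
noncomputable def parB (x : ℝ × ℝ × ℝ) : ℂ := Real.sin x.1 * Complex.exp (x.2.2 * Complex.I)

lemma exp_mul_star (t : ℝ) :
    Complex.exp (t * Complex.I) * star (Complex.exp (t * Complex.I)) = 1 := by
  rw [Complex.star_def, Complex.mul_conj, Complex.normSq_eq_norm_sq, Complex.norm_exp_ofReal_mul_I]
  simp

lemma par_unit (x : ℝ × ℝ × ℝ) : parA x * star (parA x) + parB x * star (parB x) = 1 := by
  have h1 := exp_mul_star x.2.1
  have h2 := exp_mul_star x.2.2
  have h3 : ((Real.cos x.1 : ℂ)) ^ 2 + (Real.sin x.1 : ℂ) ^ 2 = 1 := by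
    exact_mod_cast Real.cos_sq_add_sin_sq x.1
  simp only [parA, parB, star_mul']
  simp only [Complex.star_def, Complex.conj_ofReal] at *
  linear_combination h3 + (Real.cos x.1 : ℂ) ^ 2 * h1 + (Real.sin x.1 : ℂ) ^ 2 * h2

lemma par_surj (a b : ℂ) (h : ‖a‖ ^ 2 + ‖b‖ ^ 2 = 1) : ∃ x, parA x = a ∧ parB x = b := by
  refine ⟨(Real.arccos ‖a‖, Complex.arg a, Complex.arg b), ?_, ?_⟩
  · have : ‖a‖ ≤ 1 := by nlinarith [sq_nonneg ‖b‖, norm_nonneg a]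
    simp only [parA]
    rw [Real.cos_arccos (by linarith [norm_nonneg a]) this, Complex.norm_mul_exp_arg_mul_I]
  · simp only [parB]
    rw [Real.sin_arccos, show 1 - ‖a‖ ^ 2 = ‖b‖ ^ 2 by linarith, Real.sqrt_sq (norm_nonneg _),
      Complex.norm_mul_exp_arg_mul_I]

lemma rotG_bloch {n : ℕ} {j k l : Fin n} (hjk : j ≠ k) (hjl : j ≠ l) (hkl : k ≠ l) (a b : ℂ) :
    (rotG k l a b)ᴴ * blochM j k 0 * rotG k l a b =
      single j k a + single j l b + single k j (star a) + single l j (star b) := by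
  rw [rotG_conjTranspose, rotG]
  simp only [blochM, cons_val_zero, mul_add, add_mul, sub_mul, mul_sub, one_mul, mul_one,
    single_mul_single_same,
    single_mul_single_of_ne _ _ _ _ hjk, single_mul_single_of_ne _ _ _ _ hjk.symm,
    single_mul_single_of_ne _ _ _ _ hjl, single_mul_single_of_ne _ _ _ _ hjl.symm,
    single_mul_single_of_ne _ _ _ _ hkl, single_mul_single_of_ne _ _ _ _ hkl.symm]
  ext p q
  simp only [Matrix.add_apply, Matrix.sub_apply, Matrix.zero_apply, single_apply]
  split_ifs <;> simp <;> ring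

lemma rotG_one {n : ℕ} (j k : Fin n) : rotG j k 1 0 = 1 := by
  simp [rotG]

lemma exists_kernel {n m : ℕ} (j k l : Fin n) (δ : Fin m → ℝ)
    (L : (Fin m → Matrix (Fin n) (Fin n) ℂ) →ₗ[ℝ] (Fin 3 → ℝ)) :
    ∃ a b : ℂ, ‖a‖ ^ 2 + ‖b‖ ^ 2 = 1 ∧ (L fun i => δ i •
      (single j k a + single j l b + single k j (star a) + single l j (star b))) = 0 := by
  let B : (ℂ × ℂ) →ₗ[ℝ] (Fin m → Matrix (Fin n) (Fin n) ℂ) :=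
    { toFun := fun w i => δ i •
        (single j k w.1 + single j l w.2 + single k j (star w.1) + single l j (star w.2))
      map_add' := by
        intro v w
        funext i
        simp only [Prod.fst_add, Prod.snd_add, star_add, single_add, Pi.add_apply]
        module
      map_smul' := by
        intro c w
        funext i
        simp only [Prod.smul_fst, Prod.smul_snd, star_smul, star_trivial, ← smul_single,
          Pi.smul_apply, RingHom.id_apply]
        module }
  have hker : LinearMap.ker (L ∘ₗ B) ≠ ⊥ := by
    apply LinearMap.ker_ne_bot_of_finrank_lt
    simp
  obtain ⟨w, hw, hw0⟩ := (Submodule.ne_bot_iff _).1 hker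
  have hpos : 0 < ‖w.1‖ ^ 2 + ‖w.2‖ ^ 2 := by
    by_contra hcon
    have h1 : ‖w.1‖ = 0 := by nlinarith [sq_nonneg ‖w.1‖, sq_nonneg ‖w.2‖]
    have h2 : ‖w.2‖ = 0 := by nlinarith [sq_nonneg ‖w.1‖, sq_nonneg ‖w.2‖]
    exact hw0 (Prod.ext (norm_eq_zero.1 h1) (norm_eq_zero.1 h2))
  set r := Real.sqrt (‖w.1‖ ^ 2 + ‖w.2‖ ^ 2)
  have hr : r ^ 2 = ‖w.1‖ ^ 2 + ‖w.2‖ ^ 2 := Real.sq_sqrt hpos.le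
  have hr0 : 0 < r := Real.sqrt_pos.2 hpos
  refine ⟨(r⁻¹ • w).1, (r⁻¹ • w).2, ?_, ?_⟩
  · rw [Prod.smul_fst, Prod.smul_snd, norm_smul, norm_smul, mul_pow, mul_pow, ← mul_add, ← hr,
      norm_inv, Real.norm_of_nonneg hr0.le]
    field_simp
  · have : (L ∘ₗ B) (r⁻¹ • w) = 0 := by
      rw [map_smul, LinearMap.mem_ker.1 hw, smul_zero]
    exact this

lemma continuous_rotG {n : ℕ} (j k : Fin n) :
    Continuous fun x => rotG j k (parA x) (parB x) := by
  have hA : Continuous parA := by unfold parA; fun_prop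
  have hB : Continuous parB := by unfold parB; fun_prop
  refine continuous_matrix fun p q => ?_
  simp only [rotG, Matrix.add_apply, Matrix.sub_apply, single_apply]
  refine continuous_const.add (((Continuous.add ?_ ?_).sub ?_).add ?_) <;>
  · split_ifs <;> fun_prop

lemma swap_point {n m : ℕ} (hn : 2 < n) (d : Fin m → Fin n → ℝ)
    (L : (Fin m → Matrix (Fin n) (Fin n) ℂ) →ₗ[ℝ] (Fin 3 → ℝ)) (j k : Fin n) (hjk : j ≠ k)
    (s : ℝ) (h0 : 0 ≤ s) (h1 : s ≤ 1) :
    (L fun i => diagonal fun q => (((1 - s) * d i q + s * d i (Equiv.swap j k q) : ℝ) : ℂ)) ∈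
      LNumericalRange L (fun i => diagonal fun q => (d i q : ℂ)) := by
  obtain ⟨l, hl⟩ : ∃ l : Fin n, l ∉ ({j, k} : Finset (Fin n)) := by
    by_contra! hcon
    have : (Finset.univ : Finset (Fin n)) ⊆ {j, k} := fun x _ => hcon x
    have := Finset.card_le_card this
    have := Finset.card_le_two (a := j) (b := k)
    simp at *
    omega
  simp only [Finset.mem_insert, Finset.mem_singleton, not_or] at hl
  have hjl : j ≠ l := Ne.symm hl.1
  have hkl : k ≠ l := Ne.symm hl.2
  have hLc : Continuous L := LinearMap.continuous_of_finiteDimensional L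
  let G : ℝ × ℝ × ℝ → Matrix (Fin n) (Fin n) ℂ := fun x => rotG k l (parA x) (parB x)
  have hG : Continuous G := continuous_rotG k l
  let c : ℝ × ℝ × ℝ → Fin 3 → ℝ := fun x => L fun i => (G x)ᴴ * midD j k (d i) * G x
  let t : ℝ × ℝ × ℝ → Fin 3 → Fin 3 → ℝ := fun x r =>
    L fun i => ((d i j - d i k) / 2) • ((G x)ᴴ * blochM j k r * G x)
  let T : ℝ × ℝ × ℝ → Matrix (Fin 3) (Fin 3) ℝ := fun x => Matrix.of fun p r => t x r p
  have hc : Continuous c := by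
    refine hLc.comp (continuous_pi fun i => ?_)
    exact (hG.matrix_conjTranspose.matrix_mul continuous_const).matrix_mul hG
  have hT : Continuous T := by
    refine continuous_matrix fun p r => ?_
    refine (continuous_apply p).comp (hLc.comp (continuous_pi fun i => ?_))
    exact ((hG.matrix_conjTranspose.matrix_mul continuous_const).matrix_mul hG).const_smul ((d i j - d i k) / 2)
  have hTmul : ∀ x y, T x *ᵥ y = ∑ r, y r • t x r := by
    intro x y
    ext p
    simp [T, mulVec, dotProduct, mul_comm]
  have heq : ∀ x y, c x + T x *ᵥ y = L fun i => (G x)ᴴ *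
      (midD j k (d i) + ∑ r, ((d i j - d i k) / 2 * y r) • blochM j k r) * G x := by
    intro x y
    rw [hTmul]
    simp only [c, t, ← map_smul, ← map_sum, ← map_add]
    congr 1
    funext i
    simp only [Pi.add_apply, Finset.sum_apply, Pi.smul_apply, mul_add, add_mul, Finset.mul_sum,
      Finset.sum_mul, smul_smul, mul_smul_comm, smul_mul_assoc]
    congr 1
    refine Finset.sum_congr rfl fun r _ => ?_
    rw [mul_comm (y r)]
  -- degenerate point
  obtain ⟨a, b, hab, hL0⟩ := exists_kernel j k l (fun i => (d i j - d i k) / 2) L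
  obtain ⟨x1, rfl, rfl⟩ := par_surj a b hab
  have hdet : (T x1).det = 0 := by
    refine Matrix.exists_mulVec_eq_zero_iff.1 ⟨Pi.single 0 1, by simp, ?_⟩
    rw [hTmul]
    simp only [Fin.sum_univ_three]
    simp only [t, G, rotG_bloch hjk hjl hkl]
    rw [hL0]
    simp
  have hG0 : G (0, 0, 0) = 1 := by simp [G, parA, parB, rotG_one]
  obtain ⟨x, y, hy, hxy⟩ := fill_lemma c T hc hT _ (0, 0, 0) ![0, 0, 1 - 2 * s] rfl (by
    simp [dotProduct, Fin.sum_univ_three]; nlinarith) x1 hdet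
  have hstart : c (0, 0, 0) + T (0, 0, 0) *ᵥ ![0, 0, 1 - 2 * s] =
      L fun i => diagonal fun q => (((1 - s) * d i q + s * d i (Equiv.swap j k q) : ℝ) : ℂ) := by
    rw [heq, hG0]
    congr 1
    funext i
    simp only [conjTranspose_one, one_mul, mul_one, Fin.sum_univ_three, midD, blochM]
    ext p q
    simp only [Matrix.add_apply, Matrix.sub_apply, Matrix.smul_apply,
      cons_val_zero, cons_val_one, cons_val, single_apply, diagonal_apply, Complex.real_smul]
    by_cases e0 : p = q
    · subst e0
      by_cases e1 : j = p
      · subst e1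
        simp [hjk.symm]
        ring
      · by_cases e2 : k = p
        · subst e2
          simp [hjk]
          ring
        · simp [e1, e2, Equiv.swap_apply_of_ne_of_ne (Ne.symm e1) (Ne.symm e2)]
          ring
    · have e3 : ¬ (j = p ∧ j = q) := by rintro ⟨rfl, rfl⟩; exact e0 rfl
      have e4 : ¬ (k = p ∧ k = q) := by rintro ⟨rfl, rfl⟩; exact e0 rfl
      simp [e0, e3, e4]
  rw [← hstart, ← hxy, heq]
  obtain ⟨a, b, g1, g2, g3⟩ := bloch_exists y hy
  refine ⟨rotG j k a b * G x, mul_mem (rotG_mem hjk g1) (rotG_mem hkl (par_unit x)), ?_⟩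
  congr 1
  funext i
  rw [← rot_diag hjk y g1 g2 g3 (d i), conjTranspose_mul]
  simp only [Matrix.mul_assoc]

lemma isClosed_range {n m : ℕ} (L : (Fin m → Matrix (Fin n) (Fin n) ℂ) →ₗ[ℝ] (Fin 3 → ℝ))
    (A : Fin m → Matrix (Fin n) (Fin n) ℂ) : IsClosed (LNumericalRange L A) := by
  have hLc : Continuous L := LinearMap.continuous_of_finiteDimensional L
  have hK : IsCompact ((unitaryGroup (Fin n) ℂ : Submonoid _) : Set (Matrix (Fin n) (Fin n) ℂ)) :=
    by
    refine (isCompact_univ_pi fun _ : Fin n => isCompact_univ_pi fun _ : Fin n =>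
      isCompact_closedBall (0 : ℂ) 1).of_isClosed_subset (s := Set.univ.pi fun _ : Fin n =>
        Set.univ.pi fun _ : Fin n => Metric.closedBall (0 : ℂ) 1) ?_ ?_
    · have : ((unitaryGroup (Fin n) ℂ : Submonoid _) : Set (Matrix (Fin n) (Fin n) ℂ)) =
          {U : Matrix (Fin n) (Fin n) ℂ | U * Uᴴ = 1} := by
        ext U
        exact mem_unitaryGroup_iff
      rw [this]
      exact isClosed_eq (continuous_id.matrix_mul continuous_id.matrix_conjTranspose)
        continuous_const
    · intro U hU p _ q _
      rw [mem_closedBall_zero_iff]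
      exact entry_norm_bound_of_unitary hU p q
  have hf : Continuous fun U : Matrix (Fin n) (Fin n) ℂ => L fun i => Uᴴ * A i * U := by
    refine hLc.comp (continuous_pi fun i => ?_)
    exact (continuous_id.matrix_conjTranspose.matrix_mul continuous_const).matrix_mul continuous_id
  have := (hK.image hf).isClosed
  convert this using 1
  ext y
  simp only [LNumericalRange, Set.mem_ofPred_eq, Set.mem_image, SetLike.mem_coe]
  exact ⟨fun ⟨U, hU, h⟩ => ⟨U, hU, h.symm⟩, fun ⟨U, hU, h⟩ => ⟨U, hU, h.symm⟩⟩

/-- conjugation in the argument of `L` -/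
noncomputable def conjL {n m : ℕ} (L : (Fin m → Matrix (Fin n) (Fin n) ℂ) →ₗ[ℝ] (Fin 3 → ℝ))
    (U : Matrix (Fin n) (Fin n) ℂ) :
    (Fin m → Matrix (Fin n) (Fin n) ℂ) →ₗ[ℝ] (Fin 3 → ℝ) where
  toFun A := L fun i => Uᴴ * A i * U
  map_add' A B := by
    rw [← map_add]
    congr 1
    funext i
    simp [mul_add, add_mul]
  map_smul' c A := by
    rw [RingHom.id_apply, ← map_smul]
    congr 1
    funext i
    simp

lemma main_mem {n m : ℕ} (hn : 2 < n)
    (L : (Fin m → Matrix (Fin n) (Fin n) ℂ) →ₗ[ℝ] (Fin 3 → ℝ))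
    (α : ℝ) (h0 : 0 ≤ α) (h1 : α ≤ 1) (d : Fin m → Fin n → ℝ) :
    ∀ U ∈ unitaryGroup (Fin n) ℂ,
      (L fun i => Uᴴ * (diagonal fun q =>
        ((α • (1 : (Fin n → ℝ) →L[ℝ] (Fin n → ℝ)) + (1 - α) • avgOp n) (d i) q : ℂ)) * U) ∈
      LNumericalRange L (fun i => diagonal fun q => (d i q : ℂ)) := by
  let K : Set ((Fin n → ℝ) →L[ℝ] (Fin n → ℝ)) := {M | ∀ d : Fin m → Fin n → ℝ,
    ∀ U ∈ unitaryGroup (Fin n) ℂ, (L fun i => Uᴴ * (diagonal fun q => (M (d i) q : ℂ)) * U) ∈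
      LNumericalRange L (fun i => diagonal fun q => (d i q : ℂ))}
  have hLc : Continuous L := LinearMap.continuous_of_finiteDimensional L
  suffices h : α • (1 : (Fin n → ℝ) →L[ℝ] (Fin n → ℝ)) + (1 - α) • avgOp n ∈ K from h d
  refine semigroup_mem (by omega) K ?_ ?_ ?_ ?_ α h0 h1
  · simp only [K, Set.ofPred_forall]
    refine isClosed_iInter fun d => isClosed_iInter fun U => isClosed_iInter fun hU => ?_
    refine (isClosed_range L _).preimage (f := fun M : (Fin n → ℝ) →L[ℝ] (Fin n → ℝ) =>
      L fun i => Uᴴ * (diagonal fun q => (M (d i) q : ℂ)) * U) ?_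
    refine hLc.comp (continuous_pi fun i => ?_)
    refine Continuous.matrix_mul (Continuous.matrix_mul continuous_const ?_) continuous_const
    refine Continuous.matrix_diagonal (continuous_pi fun q => ?_)
    fun_prop
  · intro d U hU
    exact ⟨U, hU, rfl⟩
  · intro A hA B hB d U hU
    obtain ⟨V, hV, h⟩ := hA (fun i => B (d i)) U hU
    have := hB d V hV
    rw [← h] at this
    exact this
  · intro j k s hs0 hs1 d U hU
    by_cases hjk : j = k
    · subst hjk
      refine ⟨U, hU, ?_⟩
      congr 1
      funext i
      congr 3
      funext q
      simp [permOp]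
      ring
    · obtain ⟨V, hV, h⟩ := swap_point hn d (conjL L U) j k hjk s hs0 hs1
      refine ⟨V * U, mul_mem hV hU, ?_⟩
      simp only [conjL, LinearMap.coe_mk, AddHom.coe_mk] at h
      simp only [conjTranspose_mul, Matrix.mul_assoc] at h ⊢
      rw [← h]
      congr 1

/-- For `n > 2`, a tuple of real diagonal matrices `D` and a linear map `L : H_n^m → ℝ³`,
`W_L(D)` is star-shaped with star-center `L((tr D₁/n)·Iₙ, ..., (tr D_m/n)·Iₙ)`. -/
theorem stmt9 {n m : ℕ} (hn : 2 < n) (d : Fin m → Fin n → ℝ)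
    (L : (Fin m → Matrix (Fin n) (Fin n) ℂ) →ₗ[ℝ] (Fin 3 → ℝ)) :
    (L fun i => (Matrix.trace (Matrix.diagonal fun j => (d i j : ℂ)) / n) •
        (1 : Matrix (Fin n) (Fin n) ℂ)) ∈
      LNumericalRange L (fun i => Matrix.diagonal fun j => (d i j : ℂ)) ∧
    ∀ x ∈ LNumericalRange L (fun i => Matrix.diagonal fun j => (d i j : ℂ)),
      ∀ α ∈ Set.Icc (0 : ℝ) 1,
        α • x + (1 - α) • (L fun i =>
            (Matrix.trace (Matrix.diagonal fun j => (d i j : ℂ)) / n) •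
              (1 : Matrix (Fin n) (Fin n) ℂ)) ∈
          LNumericalRange L (fun i => Matrix.diagonal fun j => (d i j : ℂ)) := by
  have hd : ∀ (α : ℝ) (i : Fin m), (diagonal fun q =>
        ((α • (1 : (Fin n → ℝ) →L[ℝ] (Fin n → ℝ)) + (1 - α) • avgOp n) (d i) q : ℂ)) =
      α • (Matrix.diagonal fun j => (d i j : ℂ)) + (1 - α) •
        ((Matrix.trace (Matrix.diagonal fun j => (d i j : ℂ)) / n) •
          (1 : Matrix (Fin n) (Fin n) ℂ)) := by
    intro α i
    ext p q
    by_cases h : p = q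
    · subst h
      simp only [diagonal_apply_eq, Matrix.add_apply, Matrix.smul_apply, Matrix.one_apply_eq,
        trace_diagonal, Complex.real_smul, smul_eq_mul, _root_.add_apply, _root_.smul_apply,
        Pi.add_apply, Pi.smul_apply, avgOp_apply, one_apply_eq_self]
      push_cast
      ring
    · simp [h]
  constructor
  · have := main_mem hn L 0 le_rfl zero_le_one d 1 (one_mem _)
    simp only [hd] at this
    simpa using this
  · rintro x ⟨U, hU, rfl⟩ α ⟨h0, h1⟩
    have := main_mem hn L α h0 h1 d U hU
    simp only [hd] at this
    convert this using 1
    rw [← map_smul, ← map_smul, ← map_add]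
    congr 1
    funext i
    have hUU : Uᴴ * U = 1 := mem_unitaryGroup_iff'.1 hU
    simp [mul_add, add_mul, hUU]
end

section
/- Let n > 2 and let A = (A₁,...,A_m) be an m-tuple of n×n complex Hermitian matrices that are simultaneously unitarily diagonalizable, i.e., there exists a unitary U ∈ U_n such that U*A_iU is diagonal for all i = 1,...,m. Then for every linear map L : (H_n)^m → ℝ³, the L-numerical range W_L(A) is star-shaped with star-center L((tr A₁/n)·I_n, ..., (tr A_m/n)·I_n). -/
open Matrix

section P1
open scoped Matrix.Norms.L2Operator

lemma aux_path (V : Matrix (Fin 3) (Fin 3) ℂ) (hV : V ∈ Matrix.unitaryGroup (Fin 3) ℂ) :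
    ∃ γ : unitInterval → Matrix (Fin 3) (Fin 3) ℂ, Continuous γ ∧
      (∀ t, γ t ∈ Matrix.unitaryGroup (Fin 3) ℂ) ∧ γ 0 = 1 ∧
      ∃ c : ℂ, star c * c = 1 ∧ γ 1 = c • V := by
  have hfin : (spectrum ℂ V).Finite := Matrix.finite_spectrum V
  have hinf : (Metric.sphere (0:ℂ) 1).Infinite := by
    refine (isPreconnected_sphere (by rw [Complex.rank_real_complex]; norm_num) (0:ℂ) 1).infinite_of_nontrivial ?_
    refine ⟨1, by simp, -1, by simp, ?_⟩
    norm_num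
  obtain ⟨w, hw1, hw2⟩ := hinf.exists_notMem_finite hfin
  have hw : star w * w = 1 := by
    have : ‖w‖ = 1 := by simpa using hw1
    have h2 := Complex.conj_mul' w
    rw [this] at h2
    simpa using h2
  have hw0 : w ≠ 0 := by rintro rfl; simp at hw
  set c : ℂ := -star w with hc
  have hcc : star c * c = 1 := by rw [hc, star_neg, star_star, neg_mul_neg, mul_comm, hw]
  have hU : c • V ∈ unitary (Matrix (Fin 3) (Fin 3) ℂ) := by
    rw [Unitary.mem_iff]
    have h1 := hV.1
    have h2 := hV.2
    constructor
    · rw [star_smul, smul_mul_smul_comm, h1, hcc, one_smul]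
    · rw [star_smul, smul_mul_smul_comm, h2, mul_comm, hcc, one_smul]
  have hs : (-1 : ℂ) ∉ spectrum ℂ (c • V) := by
    rw [spectrum.mem_iff, not_not]
    rw [spectrum.mem_iff, not_not] at hw2
    have : (algebraMap ℂ (Matrix (Fin 3) (Fin 3) ℂ)) (-1) - c • V = algebraMap ℂ _ (star w) * (-(algebraMap ℂ _ w - V)) := by
      rw [mul_neg, mul_sub, ← map_mul, hw, hc, map_neg, map_one, neg_smul, Algebra.smul_def]
      abel
    rw [this]
    refine IsUnit.mul (IsUnit.map _ (IsUnit.mk0 _ (by simpa using hw0))) hw2.neg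
  obtain ⟨p⟩ := Unitary.joined (1 : unitary (Matrix (Fin 3) (Fin 3) ℂ)) ⟨c • V, hU⟩
    (by simpa using (Unitary.norm_sub_one_lt_two_iff hU).2 hs)
  refine ⟨fun t => (p t : Matrix (Fin 3) (Fin 3) ℂ), ?_, fun t => (p t).2, by simp, c, hcc, by simp⟩
  exact continuous_subtype_val.comp p.continuous
end P1

section P5

lemma aux_pow_sub {R : Type*} [NormedRing R] [NormOneClass R] (Q H : R) (hQ : ‖Q‖ ≤ 1) (hH : ‖H‖ ≤ 1) (N : ℕ) :
    ‖Q ^ N - H ^ N‖ ≤ N * ‖Q - H‖ := by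
  induction N with
  | zero => simp
  | succ N ih =>
    have : Q ^ (N+1) - H ^ (N+1) = Q ^ N * (Q - H) + (Q ^ N - H ^ N) * H := by
      rw [pow_succ, pow_succ]; noncomm_ring
    rw [this]
    have h1 : ‖Q ^ N‖ ≤ 1 := (norm_pow_le _ _).trans (pow_le_one₀ (norm_nonneg _) hQ)
    calc _ ≤ ‖Q ^ N * (Q - H)‖ + ‖(Q ^ N - H ^ N) * H‖ := norm_add_le _ _
      _ ≤ ‖Q ^ N‖ * ‖Q - H‖ + ‖Q ^ N - H ^ N‖ * ‖H‖ := add_le_add (norm_mul_le _ _) (norm_mul_le _ _)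
      _ ≤ 1 * ‖Q - H‖ + (N * ‖Q - H‖) * 1 := by gcongr
      _ = _ := by push_cast; ring

def AuxP {R : Type*} [NormedRing R] [NormedAlgebra ℝ R] (S : Submonoid R) (X : R) : Prop :=
  ∃ Q : ℝ → R, HasDerivAt Q X 0 ∧ Q 0 = 1 ∧ ∀ ε ∈ Set.Icc (0:ℝ) 1, Q ε ∈ S ∧ ‖Q ε‖ ≤ 1

lemma aux_sum {R : Type*} [NormedRing R] [NormOneClass R] [NormedAlgebra ℝ R] (S : Submonoid R)
    {ι : Type*} (s : Finset ι) (X : ι → R) (h : ∀ i ∈ s, AuxP S (X i)) : AuxP S (∑ i ∈ s, X i) := by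
  apply Finset.sum_induction X (AuxP S) _ _ h
  · rintro a b ⟨Q, hQ, hQ0, hQ1⟩ ⟨T, hT, hT0, hT1⟩
    refine ⟨fun x => Q x * T x, ?_, by simp [hQ0, hT0], fun ε hε => ⟨S.mul_mem (hQ1 ε hε).1 (hT1 ε hε).1, ?_⟩⟩
    · have := hQ.mul hT
      rw [hQ0, hT0, mul_one, one_mul] at this
      exact this
    · exact (norm_mul_le _ _).trans (mul_le_one₀ (hQ1 ε hε).2 (norm_nonneg _) (hT1 ε hε).2)
  · exact ⟨fun _ => 1, hasDerivAt_const _ _, rfl, fun ε _ => ⟨S.one_mem, by simp⟩⟩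

lemma aux_euler {R : Type*} [NormedRing R] [NormOneClass R] [NormedAlgebra ℝ R] (S : Submonoid R)
    (hS : IsClosed (S : Set R)) (E : R) (hE : E * E = E) (hE1 : ‖E‖ ≤ 1) (c : ℝ) (hc : 0 < c)
    (h : AuxP S (c • (E - 1))) (α : ℝ) (hα : α ∈ Set.Icc (0:ℝ) 1) : α • (1 : R) + (1 - α) • E ∈ S := by
  set G : ℝ → R := fun α => α • (1 : R) + (1 - α) • E with hG
  have hGm : ∀ a b, G a * G b = G (a * b) := by
    intro a b
    simp only [hG, add_mul, mul_add, smul_mul_assoc, mul_smul_comm, one_mul, mul_one, hE]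
    module
  have hG1 : G 1 = 1 := by simp [hG]
  have hGp : ∀ a (N : ℕ), G a ^ N = G (a ^ N) := by
    intro a N
    induction N with
    | zero => simp [hG1]
    | succ N ih => rw [pow_succ, ih, hGm, pow_succ]
  have hGn : ∀ a ∈ Set.Icc (0:ℝ) 1, ‖G a‖ ≤ 1 := by
    intro a ha
    calc ‖G a‖ ≤ ‖a • (1 : R)‖ + ‖(1 - a) • E‖ := norm_add_le _ _
      _ ≤ a * 1 + (1 - a) * 1 := by
        rw [norm_smul, norm_smul, Real.norm_of_nonneg ha.1, Real.norm_of_nonneg (sub_nonneg.2 ha.2), norm_one]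
        have := sub_nonneg.2 ha.2
        gcongr
      _ = 1 := by ring
  have hGc : Continuous G := by fun_prop
  obtain ⟨Q, hQ, hQ0, hQ1⟩ := h
  have key : ∀ t : ℝ, 0 < t → G (Real.exp (-(c * t))) ∈ S := by
    intro t ht
    set H : ℝ → R := fun ε => G (Real.exp (-(c * ε))) with hH
    have hHd : HasDerivAt H (c • (E - 1)) 0 := by
      have h1 : HasDerivAt (fun ε : ℝ => Real.exp (-(c * ε))) (-c) 0 := by
        have := ((hasDerivAt_id (0:ℝ)).const_mul c).neg.exp
        simpa using this
      have h2 := (h1.smul_const (1 : R)).add ((h1.const_sub 1).smul_const E)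
      refine h2.congr_deriv ?_
      module
    have hF : HasDerivAt (fun ε => Q ε - H ε) 0 0 := by
      have h3 := hQ.sub hHd
      rw [sub_self] at h3
      exact h3
    have hlim : Filter.Tendsto (fun N : ℕ => (N : ℝ) * ‖Q (t / N) - H (t / N)‖) Filter.atTop (nhds 0) := by
      have h3 := hF.tendsto_slope
      have h4 : Filter.Tendsto (fun N : ℕ => t / (N:ℝ)) Filter.atTop (nhdsWithin 0 {0}ᶜ) := by
        rw [tendsto_nhdsWithin_iff]
        refine ⟨tendsto_const_div_atTop_nhds_zero_nat t, ?_⟩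
        filter_upwards [Filter.eventually_gt_atTop 0] with N hN
        have : (0:ℝ) < N := by exact_mod_cast hN
        simp only [Set.mem_compl_iff, Set.mem_singleton_iff]
        positivity
      have h5 := ((h3.comp h4).norm.const_mul t)
      rw [norm_zero, mul_zero] at h5
      refine h5.congr' ?_
      filter_upwards [Filter.eventually_gt_atTop 0] with N hN
      have : (0:ℝ) < N := by exact_mod_cast hN
      have h0 : Q 0 - H 0 = 0 := by simp [hQ0, hH, hG1]
      simp only [Function.comp, slope, vsub_eq_sub, sub_zero, h0, norm_smul, norm_inv, norm_div, Real.norm_of_nonneg ht.le, Real.norm_of_nonneg this.le]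
      field_simp
    have hlim2 : Filter.Tendsto (fun N : ℕ => Q (t / N) ^ N) Filter.atTop (nhds (H t)) := by
      rw [tendsto_iff_norm_sub_tendsto_zero]
      refine squeeze_zero' (Filter.Eventually.of_forall fun _ => norm_nonneg _) ?_ hlim
      filter_upwards [Filter.eventually_gt_atTop 0, Filter.eventually_ge_atTop ⌈t⌉₊] with N hN hN2
      have hN' : (0:ℝ) < N := by exact_mod_cast hN
      have h6 : t ≤ N := (Nat.le_ceil t).trans (by exact_mod_cast hN2)
      have h7 : t / N ∈ Set.Icc (0:ℝ) 1 := ⟨by positivity, by rw [div_le_one hN']; exact h6⟩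
      have h8 : H (t / N) ^ N = H t := by
        simp only [hH]
        rw [hGp, ← Real.exp_nat_mul]
        congr 2
        field_simp
      rw [← h8]
      refine aux_pow_sub _ _ (hQ1 _ h7).2 (hGn _ ⟨Real.exp_nonneg _, ?_⟩) N
      rw [Real.exp_le_one_iff]
      have := h7.1
      have := mul_nonneg hc.le this
      linarith
    refine hS.mem_of_tendsto hlim2 ?_
    filter_upwards [Filter.eventually_gt_atTop 0, Filter.eventually_ge_atTop ⌈t⌉₊] with N hN hN2
    have hN' : (0:ℝ) < N := by exact_mod_cast hN
    have h6 : t ≤ N := (Nat.le_ceil t).trans (by exact_mod_cast hN2)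
    have h7 : t / N ∈ Set.Icc (0:ℝ) 1 := ⟨by positivity, by rw [div_le_one hN']; exact h6⟩
    exact S.pow_mem (hQ1 _ h7).1 N
  have key2 : ∀ a ∈ Set.Ioo (0:ℝ) 1, G a ∈ S := by
    intro a ha
    have := key (-Real.log a / c) (div_pos (by linarith [Real.log_neg ha.1 ha.2]) hc)
    have h2 : -(c * (-Real.log a / c)) = Real.log a := by field_simp
    rwa [h2, Real.exp_log ha.1] at this
  have hcl : α ∈ closure (Set.Ioo (0:ℝ) 1) := by rwa [closure_Ioo (by norm_num)]
  have : closure (Set.Ioo (0:ℝ) 1) ⊆ G ⁻¹' (S : Set R) :=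
    closure_minimal key2 (hS.preimage hGc)
  exact this hcl
end P5

section P2

lemma aux_repr (φ : Matrix (Fin 3) (Fin 3) ℂ →ₗ[ℝ] ℝ) :
    ∃ H : Matrix (Fin 3) (Fin 3) ℂ, H.IsHermitian ∧ ∀ X : Matrix (Fin 3) (Fin 3) ℂ, X.IsHermitian →
      φ X = (Matrix.trace (H * X)).re := by
  set G : Matrix (Fin 3) (Fin 3) ℂ := Matrix.of fun j i =>
    (⟨φ (Matrix.single i j 1), -φ (Matrix.single i j Complex.I)⟩ : ℂ) with hG
  have h1 : ∀ X, φ X = (Matrix.trace (G * X)).re := by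
    intro X
    have hX : X = ∑ i, ∑ j, ((X i j).re • Matrix.single i j (1:ℂ) + (X i j).im • Matrix.single i j Complex.I) := by
      conv_lhs => rw [Matrix.matrix_eq_sum_single X]
      refine Finset.sum_congr rfl fun i _ => Finset.sum_congr rfl fun j _ => ?_
      rw [Matrix.smul_single, Matrix.smul_single, ← Matrix.single_add]
      congr 1
      apply Complex.ext <;> simp
    conv_lhs => rw [hX]
    simp only [map_sum, map_add, map_smul, smul_eq_mul]
    simp only [Matrix.trace, Matrix.diag, Matrix.mul_apply, Complex.re_sum]
    rw [Finset.sum_comm]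
    refine Finset.sum_congr rfl fun i _ => Finset.sum_congr rfl fun j _ => ?_
    simp [hG]
    ring
  refine ⟨(1/2 : ℂ) • (G + Gᴴ), ?_, ?_⟩
  · rw [Matrix.IsHermitian, Matrix.conjTranspose_smul, Matrix.conjTranspose_add, Matrix.conjTranspose_conjTranspose, add_comm]
    simp
  · intro X hX
    have h2 : Matrix.trace (Gᴴ * X) = star (Matrix.trace (G * X)) := by
      rw [← Matrix.trace_conjTranspose, Matrix.conjTranspose_mul, hX.eq, Matrix.trace_mul_comm]
    rw [h1, Matrix.smul_mul, Matrix.trace_smul, add_mul, Matrix.trace_add, h2]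
    have : (1 / 2 : ℂ) = ((1/2 : ℝ) : ℂ) := by norm_num
    rw [this, smul_eq_mul, Complex.re_ofReal_mul]
    simp
    ring

/-- Traceless Hermitian matrix in the upper-left block. -/
noncomputable def auxS (v : Fin 3 → ℝ) : Matrix (Fin 3) (Fin 3) ℂ :=
  !![(v 2 : ℂ), (v 0 : ℂ) - (v 1 : ℂ) * Complex.I, 0; (v 0 : ℂ) + (v 1 : ℂ) * Complex.I, -(v 2 : ℂ), 0; 0, 0, 0]

lemma auxS_herm (v : Fin 3 → ℝ) : (auxS v).IsHermitian := by
  ext i j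
  fin_cases i <;> fin_cases j <;> simp [auxS, Matrix.conjTranspose_apply, sub_eq_add_neg]

lemma aux_K (a b c : ℝ) (hab : a ≤ b) (hbc : b ≤ c) : ∃ K ∈ Matrix.unitaryGroup (Fin 3) ℂ,
    ∀ v, Matrix.trace (K * Matrix.diagonal ![(a:ℂ), b, c] * Kᴴ * auxS v) = 0 := by
  obtain ⟨p, q, hpq, hb⟩ : ∃ p q : ℝ, p ^ 2 + q ^ 2 = 1 ∧ p ^ 2 * a + q ^ 2 * c = b := by
    rcases eq_or_lt_of_le (hab.trans hbc) with h | h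
    · exact ⟨1, 0, by norm_num, by subst h; linarith [le_antisymm hab hbc]⟩
    · have h1 : 0 ≤ (c - b) / (c - a) := div_nonneg (by linarith) (by linarith)
      have h2 : 0 ≤ (b - a) / (c - a) := div_nonneg (by linarith) (by linarith)
      have h3 : c - a ≠ 0 := by linarith
      refine ⟨√((c - b) / (c - a)), √((b - a) / (c - a)), ?_, ?_⟩
      · rw [Real.sq_sqrt h1, Real.sq_sqrt h2]; field_simp; ring
      · rw [Real.sq_sqrt h1, Real.sq_sqrt h2]; field_simp; ring
  have hpq' : (p:ℂ) ^ 2 + (q:ℂ) ^ 2 = 1 := by exact_mod_cast hpq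
  have hb' : (p:ℂ) ^ 2 * a + (q:ℂ) ^ 2 * c = b := by exact_mod_cast hb
  refine ⟨!![0, 1, 0; (p:ℂ), 0, q; -(q:ℂ), 0, p], ?_, ?_⟩
  · rw [Matrix.mem_unitaryGroup_iff]
    ext i j
    fin_cases i <;> fin_cases j <;> simp [Matrix.mul_apply, Fin.sum_univ_three, Matrix.star_apply] <;> first | ring1 | linear_combination hpq'
  · intro v
    simp only [Matrix.trace, Matrix.diag, Matrix.mul_apply, Fin.sum_univ_three, Matrix.conjTranspose_apply, auxS, Matrix.diagonal_apply]
    simp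
    linear_combination (-(v 2 : ℂ)) * hb'

lemma aux_sorted (H : Matrix (Fin 3) (Fin 3) ℂ) (hH : H.IsHermitian) :
    ∃ W ∈ Matrix.unitaryGroup (Fin 3) ℂ, ∃ a b c : ℝ, a ≤ b ∧ b ≤ c ∧
      Wᴴ * Matrix.diagonal ![(a:ℂ), b, c] * W = H := by
  have hσ := Tuple.monotone_sort hH.eigenvalues
  have hsp : H = hH.eigenvectorUnitary.val * Matrix.diagonal (fun i => (hH.eigenvalues i : ℂ)) *
      (hH.eigenvectorUnitary.val)ᴴ := by
    have := hH.spectral_theorem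
    rw [Unitary.conjStarAlgAut_apply] at this
    exact this
  have hWu : hH.eigenvectorUnitary.val ∈ Matrix.unitaryGroup (Fin 3) ℂ := hH.eigenvectorUnitary.2
  generalize hH.eigenvectorUnitary.val = W at hsp hWu
  generalize hH.eigenvalues = l at hσ hsp
  generalize Tuple.sort l = σ at hσ
  set P : Matrix (Fin 3) (Fin 3) ℂ := (1 : Matrix (Fin 3) (Fin 3) ℂ).submatrix σ id with hP
  have hPd : ∀ d : Fin 3 → ℂ, P * Matrix.diagonal d * Pᴴ = Matrix.diagonal (d ∘ σ) := by
    intro d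
    rw [hP, Matrix.conjTranspose_submatrix, Matrix.conjTranspose_one]
    ext i j
    simp [Matrix.mul_apply, Matrix.one_apply, Matrix.diagonal_apply]
    split_ifs with h <;> simp [h]
  have hPP : P * Pᴴ = 1 := by
    have := hPd (fun _ => 1)
    rw [Matrix.diagonal_one, mul_one] at this
    rw [this]
    exact Matrix.diagonal_one
  have hPu : P ∈ Matrix.unitaryGroup (Fin 3) ℂ := by
    rw [Matrix.mem_unitaryGroup_iff, Matrix.star_eq_conjTranspose, hPP]
  have hPP' : Pᴴ * P = 1 := hPu.1
  have hd : Matrix.diagonal ![(l (σ 0) : ℂ), l (σ 1), l (σ 2)] = P * Matrix.diagonal (fun i => (l i : ℂ)) * Pᴴ := by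
    rw [hPd]
    congr 1
    ext i; fin_cases i <;> rfl
  refine ⟨P * Wᴴ, mul_mem hPu (Unitary.star_mem hWu), l (σ 0), l (σ 1), l (σ 2), hσ (by decide), hσ (by decide), ?_⟩
  rw [hd, hsp, Matrix.conjTranspose_mul, Matrix.conjTranspose_conjTranspose]
  have e : W * Pᴴ * (P * Matrix.diagonal (fun i => (l i : ℂ)) * Pᴴ) * (P * Wᴴ) =
      W * ((Pᴴ * P) * Matrix.diagonal (fun i => (l i : ℂ)) * (Pᴴ * P)) * Wᴴ := by
    simp only [Matrix.mul_assoc]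
  rw [e, hPP', Matrix.one_mul, Matrix.mul_one]

lemma aux_degen (φ : Matrix (Fin 3) (Fin 3) ℂ →ₗ[ℝ] ℝ) :
    ∃ V ∈ Matrix.unitaryGroup (Fin 3) ℂ, ∀ v, φ (Vᴴ * auxS v * V) = 0 := by
  obtain ⟨H, hH, hφ⟩ := aux_repr φ
  obtain ⟨W, hW, a, b, c, hab, hbc, rfl⟩ := aux_sorted H hH
  obtain ⟨K, hK, hK2⟩ := aux_K a b c hab hbc
  refine ⟨K * W, mul_mem hK hW, fun v => ?_⟩
  have hWW : W * Wᴴ = 1 := hW.2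
  generalize Matrix.diagonal ![(a:ℂ), b, c] = D at *
  rw [hφ]
  · have h1 : Matrix.trace (Wᴴ * D * W * ((K * W)ᴴ * auxS v * (K * W))) =
        Matrix.trace (K * D * Kᴴ * auxS v) := by
      rw [← Matrix.mul_assoc, Matrix.trace_mul_comm, Matrix.conjTranspose_mul]
      congr 1
      have e : K * W * (Wᴴ * D * W * (Wᴴ * Kᴴ * auxS v)) =
          K * (W * Wᴴ) * D * (W * Wᴴ) * Kᴴ * auxS v := by simp only [Matrix.mul_assoc]
      rw [e, hWW, Matrix.mul_one, Matrix.mul_one]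
    rw [h1, hK2]; rfl
  · rw [Matrix.IsHermitian]
    simp only [Matrix.conjTranspose_mul, Matrix.conjTranspose_conjTranspose, Matrix.mul_assoc, (auxS_herm v).eq]

end P2
section P3

lemma aux_ab (x y z : ℝ) (h : x ^ 2 + y ^ 2 + z ^ 2 = 1) : ∃ a b : ℂ,
    star a * a = (1 + z) / 2 ∧ star b * b = (1 - z) / 2 ∧ star a * b = (x - y * Complex.I) / 2 := by
  have hz : -1 ≤ z := by nlinarith [sq_nonneg x, sq_nonneg y]
  rcases eq_or_lt_of_le hz with hz | hz
  · subst hz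
    have hx : x = 0 := by nlinarith [sq_nonneg x, sq_nonneg y]
    have hy : y = 0 := by nlinarith [sq_nonneg x, sq_nonneg y]
    subst hx hy
    exact ⟨0, 1, by simp, by norm_num, by simp⟩
  · have h0 : 0 < (1 + z) / 2 := by linarith
    set r := √((1 + z) / 2) with hr
    have hr0 : 0 < r := Real.sqrt_pos.2 h0
    have hr2 : r ^ 2 = (1 + z) / 2 := Real.sq_sqrt h0.le
    have hrc : (r : ℂ) ≠ 0 := by exact_mod_cast hr0.ne'
    have hr2' : (r : ℂ) ^ 2 = (1 + z) / 2 := by exact_mod_cast hr2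
    have h' : (x : ℂ) ^ 2 + (y:ℂ) ^ 2 + (z:ℂ) ^ 2 = 1 := by exact_mod_cast h
    refine ⟨r, (x - y * Complex.I) / (2 * r), ?_, ?_, ?_⟩
    · simp; linear_combination hr2'
    · simp
      field_simp
      ring_nf
      simp
      linear_combination h' - (2 - 2 * (z:ℂ)) * hr2'
    · simp
      field_simp

noncomputable def auxE (k : Fin 3) : Matrix (Fin 3) (Fin 3) ℂ := Matrix.single k k 1

lemma aux_g (v : Fin 3 → ℝ) (h : v 0 ^ 2 + v 1 ^ 2 + v 2 ^ 2 = 1) :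
    ∃ g ∈ Matrix.unitaryGroup (Fin 3) ℂ,
      gᴴ * auxE 0 * g = (1 / 2 : ℝ) • (auxE 0 + auxE 1 + auxS v) ∧
      gᴴ * auxE 1 * g = (1 / 2 : ℝ) • (auxE 0 + auxE 1 - auxS v) ∧
      gᴴ * auxE 2 * g = auxE 2 := by
  obtain ⟨a, b, ha, hb, hab⟩ := aux_ab _ _ _ h
  have hab2 : a * star b = (v 0 + v 1 * Complex.I) / 2 := by
    have := congrArg star hab
    simp at this
    simp [this]
  simp only [Complex.star_def] at ha hb hab hab2
  refine ⟨!![a, b, 0; -star b, star a, 0; 0, 0, 1], ?_, ?_, ?_, ?_⟩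
  · rw [Matrix.mem_unitaryGroup_iff]
    ext i j
    fin_cases i <;> fin_cases j <;> simp [Matrix.mul_apply, Fin.sum_univ_three, Matrix.star_apply] <;> first | ring1 | linear_combination ha + hb
  all_goals
    ext i j
    fin_cases i <;> fin_cases j <;>
      simp [Matrix.mul_apply, Fin.sum_univ_three, Matrix.conjTranspose_apply, auxE, auxS, Matrix.single_apply] <;>
      first
      | linear_combination ha
      | linear_combination hb
      | linear_combination hab
      | linear_combination hab2
      | linear_combination -hab
      | linear_combination -hab2
end P3

section P3b

lemma auxS_lin (v : Fin 3 → ℝ) : auxS v = ∑ j, v j • auxS (Pi.single j 1) := by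
  ext i j
  fin_cases i <;> fin_cases j <;> simp [auxS, Fin.sum_univ_three, Matrix.add_apply] <;> ring

lemma aux3 (B : Fin 3 → (Matrix (Fin 3) (Fin 3) ℂ →ₗ[ℝ] (Fin 3 → ℝ))) (u : Fin 3 → ℝ)
    (hu : u 0 ^ 2 + u 1 ^ 2 + u 2 ^ 2 ≤ 1) :
    ∃ V ∈ Matrix.unitaryGroup (Fin 3) ℂ, ∑ k, B k (Vᴴ * auxE k * V) =
      B 0 ((1 / 2 : ℝ) • (auxE 0 + auxE 1 + auxS u)) + B 1 ((1 / 2 : ℝ) • (auxE 0 + auxE 1 - auxS u))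
        + B 2 (auxE 2) := by
  by_contra! hcon
  set p := B 0 ((1 / 2 : ℝ) • (auxE 0 + auxE 1 + auxS u)) + B 1 ((1 / 2 : ℝ) • (auxE 0 + auxE 1 - auxS u))
        + B 2 (auxE 2) with hp
  have hBc : ∀ k, Continuous (B k) := fun k => (B k).continuous_of_finiteDimensional
  set M : Matrix (Fin 3) (Fin 3) ℂ → Matrix (Fin 3) (Fin 3) ℝ := fun V =>
    Matrix.of fun i j => (B 0 - B 1) ((1 / 2 : ℝ) • (Vᴴ * auxS (Pi.single j 1) * V)) i with hM
  set c : Matrix (Fin 3) (Fin 3) ℂ → (Fin 3 → ℝ) := fun V =>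
    (B 0 + B 1) ((1 / 2 : ℝ) • (Vᴴ * (auxE 0 + auxE 1) * V)) + B 2 (Vᴴ * auxE 2 * V) with hc
  have hMv : ∀ V v, M V *ᵥ v = (B 0 - B 1) ((1 / 2 : ℝ) • (Vᴴ * auxS v * V)) := by
    intro V v
    ext i
    rw [auxS_lin v]
    simp only [Matrix.mul_sum, Matrix.sum_mul, Finset.smul_sum, map_sum, Matrix.mulVec, dotProduct,
      Matrix.mul_smul, Matrix.smul_mul, Finset.sum_apply, hM, Matrix.of_apply]
    refine Finset.sum_congr rfl fun j _ => ?_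
    simp only [map_smul, Pi.smul_apply, smul_eq_mul]
    ring
  have hF : ∀ V v, c V + M V *ᵥ v = B 0 (Vᴴ * ((1 / 2 : ℝ) • (auxE 0 + auxE 1 + auxS v)) * V)
      + B 1 (Vᴴ * ((1 / 2 : ℝ) • (auxE 0 + auxE 1 - auxS v)) * V) + B 2 (Vᴴ * auxE 2 * V) := by
    intro V v
    rw [hMv, hc]
    simp only [Matrix.mul_smul, Matrix.smul_mul, map_smul, Matrix.mul_add, Matrix.add_mul, map_add,
      Matrix.mul_sub, Matrix.sub_mul, map_sub, LinearMap.add_apply, LinearMap.sub_apply]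
    module
  have hcc : Continuous c := by
    have h1 := hBc 0
    have h2 := hBc 1
    have h3 := hBc 2
    simp only [hc, LinearMap.add_apply]
    fun_prop
  have hMc : Continuous M := by
    have h1 := hBc 0
    have h2 := hBc 1
    refine continuous_matrix fun i j => ?_
    simp only [hM, LinearMap.sub_apply, Matrix.of_apply]
    fun_prop
  have hsph : ∀ V ∈ Matrix.unitaryGroup (Fin 3) ℂ, ∀ v : Fin 3 → ℝ, v 0 ^ 2 + v 1 ^ 2 + v 2 ^ 2 = 1 →
      c V + M V *ᵥ v ≠ p := by
    intro V hV v hv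
    obtain ⟨g, hg, h0, h1, h2⟩ := aux_g v hv
    have := hcon (g * V) (mul_mem hg hV)
    rw [hF, ← h0, ← h1]
    rw [Fin.sum_univ_three] at this
    simp only [Matrix.conjTranspose_mul] at this
    rw [show Vᴴ * gᴴ * auxE 2 * (g * V) = Vᴴ * (gᴴ * auxE 2 * g) * V by simp only [Matrix.mul_assoc], h2] at this
    simp only [Matrix.mul_assoc] at this ⊢
    exact this
  have hinv : ∀ V ∈ Matrix.unitaryGroup (Fin 3) ℂ, ∀ v : Fin 3 → ℝ, v 0 ^ 2 + v 1 ^ 2 + v 2 ^ 2 ≤ 1 →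
      c V + M V *ᵥ v = p → v 0 ^ 2 + v 1 ^ 2 + v 2 ^ 2 < 1 ∧ (M V).det ≠ 0 := by
    intro V hV v hv hp
    refine ⟨lt_of_le_of_ne hv fun h => hsph V hV v h hp, fun hdet => ?_⟩
    obtain ⟨w, hw0, hw⟩ := Matrix.exists_mulVec_eq_zero_iff.2 hdet
    have hpos : 0 < w 0 ^ 2 + w 1 ^ 2 + w 2 ^ 2 := by
      by_contra! hle
      apply hw0
      have a0 : w 0 = 0 := by nlinarith [sq_nonneg (w 0), sq_nonneg (w 1), sq_nonneg (w 2)]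
      have a1 : w 1 = 0 := by nlinarith [sq_nonneg (w 0), sq_nonneg (w 1), sq_nonneg (w 2)]
      have a2 : w 2 = 0 := by nlinarith [sq_nonneg (w 0), sq_nonneg (w 1), sq_nonneg (w 2)]
      ext i; fin_cases i <;> simp [a0, a1, a2]
    set a := w 0 ^ 2 + w 1 ^ 2 + w 2 ^ 2 with ha
    set b := 2 * (v 0 * w 0 + v 1 * w 1 + v 2 * w 2) with hb
    set d := v 0 ^ 2 + v 1 ^ 2 + v 2 ^ 2 - 1 with hd
    have hdisc : 0 ≤ discrim a b d := by
      rw [discrim]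
      have : a * d ≤ 0 := mul_nonpos_of_nonneg_of_nonpos hpos.le (by linarith)
      nlinarith [sq_nonneg b]
    obtain ⟨r, hr⟩ := exists_quadratic_eq_zero (a := a) (b := b) (c := d) hpos.ne'
      ⟨√(discrim a b d), (Real.mul_self_sqrt hdisc).symm⟩
    refine hsph V hV (v + r • w) ?_ ?_
    · simp only [Pi.add_apply, Pi.smul_apply, smul_eq_mul]
      linear_combination hr
    · rw [Matrix.mulVec_add, Matrix.mulVec_smul, hw, smul_zero, add_zero, hp]
  obtain ⟨V1, hV1, hdeg⟩ := aux_degen ((LinearMap.proj 0).comp (B 0 - B 1))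
  obtain ⟨γ, hγc, hγu, hγ0, e, he, hγ1⟩ := aux_path V1 hV1
  set T : Set unitInterval := {t | ∃ v : Fin 3 → ℝ, v 0 ^ 2 + v 1 ^ 2 + v 2 ^ 2 ≤ 1 ∧
    c (γ t) + M (γ t) *ᵥ v = p} with hT
  have hTcl : IsClosed T := by
    set C : Set (unitInterval × (Fin 3 → ℝ)) := {x | x.2 0 ^ 2 + x.2 1 ^ 2 + x.2 2 ^ 2 ≤ 1 ∧
      c (γ x.1) + M (γ x.1) *ᵥ x.2 = p} with hC
    have hCcl : IsClosed C := by
      refine IsClosed.and (isClosed_le (f := fun x : unitInterval × (Fin 3 → ℝ) =>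
        x.2 0 ^ 2 + x.2 1 ^ 2 + x.2 2 ^ 2) (by fun_prop) continuous_const) (isClosed_eq ?_ continuous_const)
      have h1 : Continuous fun x : unitInterval × (Fin 3 → ℝ) => M (γ x.1) := by fun_prop
      exact (by fun_prop : Continuous fun x : unitInterval × (Fin 3 → ℝ) => c (γ x.1)).add
        (h1.matrix_mulVec continuous_snd)
    have hCc : IsCompact C := by
      refine (isCompact_univ.prod (isCompact_Icc (a := (fun _ => -1 : Fin 3 → ℝ)) (b := fun _ => 1))).of_isClosed_subset hCcl ?_
      rintro ⟨t, v⟩ ⟨hv, -⟩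
      simp only at hv
      refine ⟨Set.mem_univ _, ?_, ?_⟩ <;> intro i <;> fin_cases i <;> simp <;>
        nlinarith [sq_nonneg (v 0), sq_nonneg (v 1), sq_nonneg (v 2)]
    have : T = Prod.fst '' C := by
      ext t; constructor
      · rintro ⟨v, h1, h2⟩; exact ⟨(t, v), ⟨h1, h2⟩, rfl⟩
      · rintro ⟨⟨t', v⟩, ⟨h1, h2⟩, rfl⟩; exact ⟨v, h1, h2⟩
    rw [this]
    exact (hCc.image continuous_fst).isClosed
  have hTo : IsOpen T := by
    rw [isOpen_iff_mem_nhds]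
    rintro t ⟨v, hv, hvp⟩
    obtain ⟨hlt, hdet⟩ := hinv _ (hγu t) v hv hvp
    have hdc : Continuous fun t => (M (γ t)).det := (hMc.comp hγc).matrix_det
    set w : unitInterval → Fin 3 → ℝ := fun t =>
      ((M (γ t)).det)⁻¹ • ((M (γ t)).adjugate *ᵥ (p - c (γ t))) with hw
    have hwc : ContinuousAt w t := by
      refine (hdc.continuousAt.inv₀ hdet).smul ?_
      exact ((hMc.comp hγc).matrix_adjugate.matrix_mulVec (continuous_const.sub (hcc.comp hγc))).continuousAt
    have hwt : w t = v := by
      have : p - c (γ t) = M (γ t) *ᵥ v := by rw [← hvp]; abel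
      simp only [hw]
      rw [this, Matrix.mulVec_mulVec, Matrix.adjugate_mul, Matrix.smul_mulVec, Matrix.one_mulVec, smul_smul,
        inv_mul_cancel₀ hdet, one_smul]
    have hq : ContinuousAt (fun t => w t 0 ^ 2 + w t 1 ^ 2 + w t 2 ^ 2) t := by
      have h := fun i => (continuousAt_pi.1 hwc) i
      exact (((h 0).pow 2).add ((h 1).pow 2)).add ((h 2).pow 2)
    have e1 := hq.eventually_lt (continuousAt_const (y := (1:ℝ))) (by simp only [hwt]; exact hlt)
    have e2 := hdc.continuousAt.eventually_ne hdet
    filter_upwards [e1, e2] with s h1 h2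
    refine ⟨w s, h1.le, ?_⟩
    simp only [hw]
    rw [Matrix.mulVec_smul, Matrix.mulVec_mulVec, Matrix.mul_adjugate, Matrix.smul_mulVec, Matrix.one_mulVec, smul_smul,
        inv_mul_cancel₀ h2, one_smul]
    abel
  have hT0 : (0 : unitInterval) ∈ T := by
    refine ⟨u, hu, ?_⟩
    rw [hF, hγ0]
    simp [hp]
  have hTu : T = Set.univ := IsClopen.eq_univ ⟨hTcl, hTo⟩ ⟨0, hT0⟩
  obtain ⟨v, hv, hvp⟩ : (1 : unitInterval) ∈ T := hTu ▸ Set.mem_univ _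
  apply (hinv _ (hγu 1) v hv hvp).2
  apply Matrix.det_eq_zero_of_row_eq_zero 0
  intro j
  have := hdeg (Pi.single j 1)
  simp only [hM, Matrix.of_apply, hγ1]
  rw [map_smul, Pi.smul_apply, Matrix.conjTranspose_smul, Matrix.smul_mul, Matrix.smul_mul, Matrix.mul_smul, smul_smul, he, one_smul]
  simp only [LinearMap.comp_apply, LinearMap.proj_apply] at this
  rw [this, smul_zero]

end P3b

section P4

noncomputable def auxPhi {n : ℕ} (B : Fin n → (Matrix (Fin n) (Fin n) ℂ →ₗ[ℝ] (Fin 3 → ℝ)))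
    (U : Matrix (Fin n) (Fin n) ℂ) : Fin 3 → ℝ :=
  ∑ k, B k (Uᴴ * Matrix.single k k 1 * U)

noncomputable def auxAct {n : ℕ} (D : Matrix (Fin n) (Fin n) ℝ)
    (B : Fin n → (Matrix (Fin n) (Fin n) ℂ →ₗ[ℝ] (Fin 3 → ℝ))) :
    Fin n → (Matrix (Fin n) (Fin n) ℂ →ₗ[ℝ] (Fin 3 → ℝ)) :=
  fun k => ∑ l, D k l • B l

lemma auxAct_one {n : ℕ} (B : Fin n → (Matrix (Fin n) (Fin n) ℂ →ₗ[ℝ] (Fin 3 → ℝ))) :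
    auxAct 1 B = B := by
  ext k : 1
  simp [auxAct, Matrix.one_apply]

lemma auxAct_mul {n : ℕ} (D D' : Matrix (Fin n) (Fin n) ℝ)
    (B : Fin n → (Matrix (Fin n) (Fin n) ℂ →ₗ[ℝ] (Fin 3 → ℝ))) :
    auxAct (D * D') B = auxAct D (auxAct D' B) := by
  ext k : 1
  simp only [auxAct, Matrix.mul_apply, Finset.sum_smul, Finset.smul_sum, smul_smul]
  rw [Finset.sum_comm]

def auxMon (n : ℕ) : Submonoid (Matrix (Fin n) (Fin n) ℝ) where
  carrier := {D | ∀ B, ∀ U ∈ Matrix.unitaryGroup (Fin n) ℂ, ∃ V ∈ Matrix.unitaryGroup (Fin n) ℂ,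
    auxPhi B V = auxPhi (auxAct D B) U}
  one_mem' := fun B U hU => ⟨U, hU, by rw [auxAct_one]⟩
  mul_mem' := by
    intro D D' hD hD' B U hU
    obtain ⟨V, hV, h⟩ := hD (auxAct D' B) U hU
    obtain ⟨V', hV', h'⟩ := hD' B V hV
    exact ⟨V', hV', by rw [h', h, auxAct_mul]⟩

lemma aux_compact (n : ℕ) : IsCompact (Matrix.unitaryGroup (Fin n) ℂ : Set (Matrix (Fin n) (Fin n) ℂ)) := by
  have hK : IsCompact (Set.pi Set.univ (fun _ : Fin n => Set.pi Set.univ fun _ : Fin n => Metric.closedBall (0:ℂ) 1)) :=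
    isCompact_univ_pi fun _ => isCompact_univ_pi fun _ => isCompact_closedBall _ _
  have hcl : IsClosed (Matrix.unitaryGroup (Fin n) ℂ : Set (Matrix (Fin n) (Fin n) ℂ)) := by
    have : (Matrix.unitaryGroup (Fin n) ℂ : Set (Matrix (Fin n) (Fin n) ℂ)) = {U | U * Uᴴ = 1} := by
      ext U; exact Matrix.mem_unitaryGroup_iff
    rw [this]
    exact isClosed_eq (by fun_prop) continuous_const
  refine IsCompact.of_isClosed_subset (t := _) hK hcl ?_
  intro U hU i _ j _
  simpa using entry_norm_bound_of_unitary hU i j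

lemma aux_closed (n : ℕ) : IsClosed (auxMon n : Set (Matrix (Fin n) (Fin n) ℝ)) := by
  have : (auxMon n : Set (Matrix (Fin n) (Fin n) ℝ)) = ⋂ B, ⋂ U ∈ Matrix.unitaryGroup (Fin n) ℂ,
      (fun D => auxPhi (auxAct D B) U) ⁻¹' (auxPhi B '' (Matrix.unitaryGroup (Fin n) ℂ : Set _)) := by
    ext D
    simp only [Set.mem_iInter, Set.mem_preimage, Set.mem_image]
    rfl
  rw [this]
  refine isClosed_iInter fun B => isClosed_iInter fun U => isClosed_iInter fun _ => ?_
  have hB : ∀ k, Continuous (B k) := fun k => (B k).continuous_of_finiteDimensional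
  refine IsClosed.preimage ?_ (IsCompact.isClosed ((aux_compact n).image ?_))
  · simp only [auxPhi, auxAct, LinearMap.sum_apply, LinearMap.smul_apply]
    fun_prop
  · unfold auxPhi
    fun_prop

noncomputable def auxP (n : ℕ) (i j : Fin n) : Matrix (Fin n) (Fin n) ℝ :=
  Matrix.of fun a b => if Equiv.swap i j a = b then 1 else 0

lemma aux_single {n : ℕ} (e : Fin 3 → Fin n) (a : Fin 3) : Matrix.single (e a) (e a) (1:ℂ) =
    (Matrix.of fun a b => if a = e b then (1:ℂ) else 0) * Matrix.single a a (1:ℂ) *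
      (Matrix.of fun a b => if a = e b then (1:ℂ) else 0)ᴴ := by
  ext x y
  rw [Matrix.mul_apply, Finset.sum_eq_single a]
  · rw [Matrix.mul_single_apply_same, Matrix.single_apply, Matrix.conjTranspose_apply, Matrix.of_apply,
      Matrix.of_apply]
    by_cases h1 : x = e a <;> by_cases h2 : y = e a <;> simp [h1, h2, eq_comm]
  · intro b _ hb
    rw [Matrix.mul_single_apply_of_ne _ _ _ _ _ hb, zero_mul]
  · simp

lemma aux_lin {n : ℕ} (E : Matrix (Fin n) (Fin 3) ℂ) (X Y : Matrix (Fin 3) (Fin 3) ℂ) (ε : ℝ) :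
    E * ((1 / 2 : ℝ) • (X + Y + (1 - 2 * ε) • (X - Y))) * Eᴴ =
      (1 - ε) • (E * X * Eᴴ) + ε • (E * Y * Eᴴ) := by
  have : (1 / 2 : ℝ) • (X + Y + (1 - 2 * ε) • (X - Y)) = (1 - ε) • X + ε • Y := by module
  rw [this]
  simp only [Matrix.mul_add, Matrix.add_mul, Matrix.mul_smul, Matrix.smul_mul]

lemma aux_lin' {n : ℕ} (E : Matrix (Fin n) (Fin 3) ℂ) (X Y : Matrix (Fin 3) (Fin 3) ℂ) (ε : ℝ) :
    E * ((1 / 2 : ℝ) • (X + Y - (1 - 2 * ε) • (X - Y))) * Eᴴ =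
      (1 - ε) • (E * Y * Eᴴ) + ε • (E * X * Eᴴ) := by
  have : (1 / 2 : ℝ) • (X + Y - (1 - 2 * ε) • (X - Y)) = (1 - ε) • Y + ε • X := by module
  rw [this]
  simp only [Matrix.mul_add, Matrix.add_mul, Matrix.mul_smul, Matrix.smul_mul]

set_option maxHeartbeats 1000000 in
lemma aux_transf {n : ℕ} (hn : 2 < n) (i j : Fin n) (ε : ℝ) (hε : ε ∈ Set.Icc (0:ℝ) 1) :
    (1 - ε) • (1 : Matrix (Fin n) (Fin n) ℝ) + ε • auxP n i j ∈ auxMon n := by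
  by_cases hij : i = j
  · subst hij
    have : auxP n i i = 1 := by
      ext a b; simp [auxP, Matrix.one_apply]
    rw [this, ← add_smul, sub_add_cancel, one_smul]
    exact one_mem _
  obtain ⟨r, hr⟩ : ∃ r : Fin n, r ∉ ({i, j} : Finset (Fin n)) := by
    by_contra! h
    have h1 : (Finset.univ : Finset (Fin n)) ⊆ {i, j} := fun x _ => h x
    have h2 := Finset.card_le_card h1
    have h3 := Finset.card_le_two (a := i) (b := j)
    simp at h2
    omega
  simp only [Finset.mem_insert, Finset.mem_singleton, not_or] at hr
  obtain ⟨hri, hrj⟩ := hr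
  intro B U hU
  set e : Fin 3 → Fin n := ![i, j, r] with he
  have hinj : Function.Injective e := by
    intro a b
    fin_cases a <;> fin_cases b <;> simp [he, hij, Ne.symm hij, hri, hrj, Ne.symm hri, Ne.symm hrj] <;> tauto
  set E : Matrix (Fin n) (Fin 3) ℂ := Matrix.of fun a b => if a = e b then 1 else 0 with hE
  have hEE : Eᴴ * E = 1 := by
    ext a b
    simp [hE, Matrix.mul_apply, Matrix.one_apply, hinj.eq_iff]
    grind
  have hs : ∀ a, Matrix.single (e a) (e a) (1:ℂ) = E * auxE a * Eᴴ := by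
    intro a
    rw [auxE, hE]
    exact aux_single e a
  have hs1 : ∀ k, (∀ a, e a ≠ k) → Matrix.single k k (1:ℂ) * E = 0 := by
    intro k hk
    ext x y
    simp [hE, Matrix.mul_apply, Matrix.single_apply]
    grind
  have hs2 : ∀ k, (∀ a, e a ≠ k) → Eᴴ * Matrix.single k k (1:ℂ) = 0 := by
    intro k hk
    have := congrArg Matrix.conjTranspose (hs1 k hk)
    simpa using this
  clear_value E
  set B3 : Fin 3 → (Matrix (Fin 3) (Fin 3) ℂ →ₗ[ℝ] (Fin 3 → ℝ)) := fun a =>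
    (B (e a)).comp
      ({ toFun := fun X => Uᴴ * (E * X * Eᴴ) * U
         map_add' := by intro X Y; simp only [Matrix.mul_add, Matrix.add_mul]
         map_smul' := by intro c X; simp } :
        Matrix (Fin 3) (Fin 3) ℂ →ₗ[ℝ] Matrix (Fin n) (Fin n) ℂ) with hB3
  obtain ⟨V, hV, hVe⟩ := aux3 B3 ![0, 0, 1 - 2 * ε] (by
    simp
    have := hε.1
    have := hε.2
    rw [abs_le]; constructor <;> linarith)
  have hV1 : Vᴴ * V = 1 := hV.1
  have hV2 : V * Vᴴ = 1 := hV.2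
  set Z : Matrix (Fin n) (Fin n) ℂ := E * V * Eᴴ + (1 - E * Eᴴ) with hZ
  have hZE : Zᴴ * E = E * Vᴴ := by
    simp only [hZ, Matrix.conjTranspose_add, Matrix.conjTranspose_sub, Matrix.conjTranspose_mul,
      Matrix.conjTranspose_conjTranspose, Matrix.conjTranspose_one, Matrix.add_mul, Matrix.sub_mul,
      Matrix.mul_assoc, hEE, Matrix.one_mul, Matrix.mul_one, sub_self, add_zero]
  have hEZ : Eᴴ * Z = V * Eᴴ := by
    have := congrArg Matrix.conjTranspose hZE
    simpa using this
  have hZu : Z ∈ Matrix.unitaryGroup (Fin n) ℂ := by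
    rw [Matrix.mem_unitaryGroup_iff', Matrix.star_eq_conjTranspose]
    conv_lhs => rw [hZ]
    rw [← hZ, Matrix.mul_add, Matrix.mul_sub, Matrix.mul_one, ← Matrix.mul_assoc, ← Matrix.mul_assoc, ← Matrix.mul_assoc, hZE]
    simp only [hZ, Matrix.conjTranspose_add, Matrix.conjTranspose_sub, Matrix.conjTranspose_mul,
      Matrix.conjTranspose_conjTranspose, Matrix.conjTranspose_one, Matrix.mul_assoc]
    rw [← Matrix.mul_assoc Vᴴ, hV1, Matrix.one_mul]
    abel
  have hk1 : ∀ a, Zᴴ * Matrix.single (e a) (e a) 1 * Z = E * (Vᴴ * auxE a * V) * Eᴴ := by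
    intro a
    have : Zᴴ * (E * auxE a * Eᴴ) * Z = (Zᴴ * E) * auxE a * (Eᴴ * Z) := by simp only [Matrix.mul_assoc]
    rw [hs, this, hZE, hEZ]
    simp only [Matrix.mul_assoc]
  have hk2 : ∀ k, (∀ a, e a ≠ k) → Zᴴ * Matrix.single k k 1 * Z = Matrix.single k k 1 := by
    intro k hk
    have h1 : Matrix.single k k (1:ℂ) * Z = Matrix.single k k 1 := by
      rw [hZ, Matrix.mul_add, Matrix.mul_sub, Matrix.mul_one, ← Matrix.mul_assoc, ← Matrix.mul_assoc, ← Matrix.mul_assoc, hs1 k hk]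
      simp
    have h2 : Zᴴ * Matrix.single k k (1:ℂ) = Matrix.single k k 1 := by
      have := congrArg Matrix.conjTranspose h1
      simpa using this
    rw [h2, h1]
  refine ⟨Z * U, mul_mem hZu hU, ?_⟩
  have hL : auxPhi B (Z * U) = ∑ k, B k (Uᴴ * (Zᴴ * Matrix.single k k 1 * Z) * U) := by
    simp only [auxPhi, Matrix.conjTranspose_mul, Matrix.mul_assoc]
  have hR : auxPhi (auxAct ((1 - ε) • (1 : Matrix (Fin n) (Fin n) ℝ) + ε • auxP n i j) B) U =
      ∑ k, B k (Uᴴ * ((1 - ε) • Matrix.single k k 1 + ε • Matrix.single (Equiv.swap i j k) (Equiv.swap i j k) 1) * U) := by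
    have h1 : ∀ k, auxAct ((1 - ε) • (1 : Matrix (Fin n) (Fin n) ℝ) + ε • auxP n i j) B k =
        (1 - ε) • B k + ε • B (Equiv.swap i j k) := by
      intro k
      simp [auxAct, auxP, Matrix.one_apply, add_smul, Finset.sum_add_distrib]
    simp only [auxPhi, h1, LinearMap.add_apply, LinearMap.smul_apply, Matrix.mul_add, Matrix.add_mul,
      Matrix.mul_smul, Matrix.smul_mul, map_add, map_smul, Finset.sum_add_distrib]
    congr 1
    rw [← Equiv.sum_comp (Equiv.swap i j)]
    simp
  rw [hL, hR]
  set s : Finset (Fin n) := Finset.univ.image e with hs'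
  rw [← Finset.sum_add_sum_compl s, ← Finset.sum_add_sum_compl s (f := fun k => B k (Uᴴ * ((1 - ε) • Matrix.single k k 1 + ε • Matrix.single (Equiv.swap i j k) (Equiv.swap i j k) 1) * U))]
  congr 1
  · rw [hs', Finset.sum_image (fun a _ b _ h => hinj h), Finset.sum_image (fun a _ b _ h => hinj h)]
    have hl : ∀ a, B (e a) (Uᴴ * (Zᴴ * Matrix.single (e a) (e a) 1 * Z) * U) = B3 a (Vᴴ * auxE a * V) := by
      intro a
      rw [hk1]; rfl
    have hS : auxS ![0, 0, 1 - 2 * ε] = (1 - 2 * ε) • (auxE 0 - auxE 1) := by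
      ext x y
      fin_cases x <;> fin_cases y <;> simp [auxS, auxE, Matrix.single_apply]
    rw [Finset.sum_congr rfl fun a _ => hl a, hVe, Fin.sum_univ_three, hS]
    have e0 : e 0 = i := rfl
    have e1 : e 1 = j := rfl
    have e2 : e 2 = r := rfl
    have w0 : Equiv.swap i j (e 0) = e 1 := by rw [e0, e1, Equiv.swap_apply_left]
    have w1 : Equiv.swap i j (e 1) = e 0 := by rw [e0, e1, Equiv.swap_apply_right]
    have w2 : Equiv.swap i j (e 2) = e 2 := by rw [e2, Equiv.swap_apply_of_ne_of_ne hri hrj]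
    rw [w0, w1, w2]
    have hb : ∀ a X, B3 a X = B (e a) (Uᴴ * (E * X * Eᴴ) * U) := fun a X => rfl
    rw [hb, hb, hb, aux_lin, aux_lin', hs, hs, hs, ← add_smul, sub_add_cancel, one_smul]
  · refine Finset.sum_congr rfl fun k hk => ?_
    have hk' : ∀ a, e a ≠ k := by
      intro a h
      simp [hs'] at hk
      exact hk a h
    have hki : k ≠ i := fun h => hk' 0 h.symm
    have hkj : k ≠ j := fun h => hk' 1 h.symm
    rw [hk2 k hk', Equiv.swap_apply_of_ne_of_ne hki hkj, ← add_smul, sub_add_cancel, one_smul]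
end P4

section P6
open scoped Matrix.Norms.Operator

lemma aux_norm {n : ℕ} (D : Matrix (Fin n) (Fin n) ℝ) (h0 : ∀ i j, 0 ≤ D i j) (h1 : ∀ i, ∑ j, D i j ≤ 1) :
    ‖D‖ ≤ 1 := by
  rw [Matrix.linfty_opNorm_def]
  have : (Finset.univ.sup fun i => ∑ j, ‖D i j‖₊) ≤ 1 := by
    refine Finset.sup_le fun i _ => ?_
    rw [← NNReal.coe_le_coe]
    push_cast
    refine le_trans (le_of_eq ?_) (h1 i)
    refine Finset.sum_congr rfl fun j _ => Real.norm_of_nonneg (h0 i j)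
  exact_mod_cast this

lemma aux_G {n : ℕ} (hn : 2 < n) (α : ℝ) (hα : α ∈ Set.Icc (0:ℝ) 1) :
    α • (1 : Matrix (Fin n) (Fin n) ℝ) + (1 - α) • (Matrix.of fun _ _ => (1 / n : ℝ)) ∈ auxMon n := by
  have hn0 : (n : ℝ) ≠ 0 := by positivity
  haveI : Nonempty (Fin n) := ⟨⟨0, by omega⟩⟩
  haveI : NormOneClass (Matrix (Fin n) (Fin n) ℝ) := inferInstance
  refine aux_euler (auxMon n) (aux_closed n) _ ?_ ?_ (2 * n) (by positivity) ?_ α hα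
  · ext a b
    simp [Matrix.mul_apply]
    field_simp
  · refine aux_norm _ (fun _ _ => by simp) (fun _ => by simp [hn0])
  · have hsum : (2 * n : ℝ) • ((Matrix.of fun _ _ => (1 / n : ℝ)) - (1 : Matrix (Fin n) (Fin n) ℝ)) =
        ∑ p : Fin n × Fin n, (auxP n p.1 p.2 - 1) := by
      have hent : ∀ i j a b : Fin n, auxP n i j a b - (1 : Matrix (Fin n) (Fin n) ℝ) a b =
          -(((if a = i then 1 else 0) - (if a = j then 1 else 0)) * ((if b = i then 1 else 0) - (if b = j then 1 else 0))) := by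
        intro i j a b
        simp only [auxP, Matrix.of_apply, Matrix.one_apply, Equiv.swap_apply_def]
        grind
      ext a b
      rw [Fintype.sum_prod_type]
      simp only [Matrix.sum_apply, Matrix.sub_apply, hent, Matrix.smul_apply, Matrix.of_apply, smul_eq_mul]
      simp [mul_sub, sub_mul, Finset.sum_sub_distrib, Finset.sum_add_distrib, Matrix.one_apply]
      split_ifs with h
      · field_simp; ring
      · field_simp; ring
    rw [hsum]
    refine aux_sum _ _ _ fun p _ => ⟨fun ε => (1 - ε) • 1 + ε • auxP n p.1 p.2, ?_, by simp, fun ε hε => ⟨aux_transf hn _ _ ε hε, ?_⟩⟩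
    · have h1 := (((hasDerivAt_id (0:ℝ)).const_sub 1).smul_const (1 : Matrix (Fin n) (Fin n) ℝ)).add
        ((hasDerivAt_id (0:ℝ)).smul_const (auxP n p.1 p.2))
      refine h1.congr_deriv ?_
      module
    · have hε1 : 0 ≤ 1 - ε := by linarith [hε.2]
      refine aux_norm _ (fun a b => ?_) (fun a => ?_)
      · simp only [Matrix.add_apply, Matrix.smul_apply, auxP, Matrix.of_apply, Matrix.one_apply, smul_eq_mul]
        have := hε.1
        split_ifs <;> positivity
      · simp [auxP, Matrix.one_apply, Finset.sum_add_distrib]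
end P6

theorem stmt10 {n m : ℕ} (hn : 2 < n) (A : Fin m → Matrix (Fin n) (Fin n) ℂ)
    (hA : ∀ i, (A i).IsHermitian)
    (hdiag : ∃ U ∈ Matrix.unitaryGroup (Fin n) ℂ, ∀ i, (Uᴴ * A i * U).IsDiag)
    (L : (Fin m → Matrix (Fin n) (Fin n) ℂ) →ₗ[ℝ] (Fin 3 → ℝ)) :
    (L fun i => (Matrix.trace (A i) / n) • (1 : Matrix (Fin n) (Fin n) ℂ)) ∈
      LNumericalRange L A ∧
    ∀ x ∈ LNumericalRange L A, ∀ α ∈ Set.Icc (0 : ℝ) 1,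
      α • x + (1 - α) •
          (L fun i => (Matrix.trace (A i) / n) • (1 : Matrix (Fin n) (Fin n) ℂ)) ∈
        LNumericalRange L A := by
  obtain ⟨U0, hU0, hd⟩ := hdiag
  have h01 : U0ᴴ * U0 = 1 := hU0.1
  have h02 : U0 * U0ᴴ = 1 := hU0.2
  have hn0 : (n : ℝ) ≠ 0 := by positivity
  set d : Fin m → Fin n → ℂ := fun i => (U0ᴴ * A i * U0).diag with hdd
  have hAd : ∀ i, A i = U0 * Matrix.diagonal (d i) * U0ᴴ := by
    intro i
    rw [hdd, (hd i).diagonal_diag]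
    have : U0 * (U0ᴴ * A i * U0) * U0ᴴ = (U0 * U0ᴴ) * A i * (U0 * U0ᴴ) := by simp only [Matrix.mul_assoc]
    rw [this, h02, Matrix.one_mul, Matrix.mul_one]
  have htr : ∀ i, Matrix.trace (A i) = ∑ k, d i k := by
    intro i
    rw [hAd i, Matrix.trace_mul_comm, ← Matrix.mul_assoc, h01, Matrix.one_mul, Matrix.trace_diagonal]
  set B : Fin n → (Matrix (Fin n) (Fin n) ℂ →ₗ[ℝ] (Fin 3 → ℝ)) := fun k =>
    L.comp
      ({ toFun := fun X i => d i k • X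
         map_add' := by intro X Y; ext1 i; simp
         map_smul' := by intro c X; ext1 i; exact smul_comm (d i k) c X } :
        Matrix (Fin n) (Fin n) ℂ →ₗ[ℝ] (Fin m → Matrix (Fin n) (Fin n) ℂ)) with hB
  have hBapp : ∀ k X, B k X = L fun i => d i k • X := fun k X => rfl
  have hphi : ∀ V, auxPhi B V = L fun i => Vᴴ * Matrix.diagonal (d i) * V := by
    intro V
    simp only [auxPhi, hBapp, ← map_sum]
    congr 1
    ext1 i
    rw [Finset.sum_apply]
    have : Matrix.diagonal (d i) = ∑ k, d i k • Matrix.single k k (1:ℂ) := by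
      rw [← Matrix.sum_single_eq_diagonal]; simp
    rw [this]
    simp only [Matrix.mul_sum, Matrix.sum_mul, Matrix.mul_smul, Matrix.smul_mul]
  have hmem : ∀ y, y ∈ LNumericalRange L A ↔ ∃ V ∈ Matrix.unitaryGroup (Fin n) ℂ, auxPhi B V = y := by
    intro y
    constructor
    · rintro ⟨U, hU, rfl⟩
      refine ⟨U0ᴴ * U, mul_mem (Unitary.star_mem hU0) hU, ?_⟩
      rw [hphi]
      congr 1; ext1 i
      rw [hAd i]
      simp only [Matrix.conjTranspose_mul, Matrix.conjTranspose_conjTranspose, Matrix.mul_assoc]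
    · rintro ⟨V, hV, rfl⟩
      refine ⟨U0 * V, mul_mem hU0 hV, ?_⟩
      rw [hphi]
      congr 1; ext1 i
      rw [hAd i]
      have : (U0 * V)ᴴ * (U0 * Matrix.diagonal (d i) * U0ᴴ) * (U0 * V) =
          Vᴴ * (U0ᴴ * U0) * Matrix.diagonal (d i) * (U0ᴴ * U0) * V := by
        simp only [Matrix.conjTranspose_mul, Matrix.mul_assoc]
      rw [this, h01, Matrix.mul_one, Matrix.mul_one]
  have hcen : (L fun i => (Matrix.trace (A i) / n) • (1 : Matrix (Fin n) (Fin n) ℂ)) =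
      ∑ k, (1 / n : ℝ) • B k 1 := by
    simp only [hBapp, ← map_smul, ← map_sum]
    congr 1
    ext1 i
    rw [Finset.sum_apply]
    simp only [Pi.smul_apply]
    rw [← Finset.smul_sum, ← Finset.sum_smul, ← htr, div_eq_inv_mul, ← smul_smul]
    ext a b
    simp
  have hstar : ∀ x ∈ LNumericalRange L A, ∀ α ∈ Set.Icc (0 : ℝ) 1,
      α • x + (1 - α) •
          (L fun i => (Matrix.trace (A i) / n) • (1 : Matrix (Fin n) (Fin n) ℂ)) ∈
        LNumericalRange L A := by
    intro x hx α hα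
    obtain ⟨V, hV, rfl⟩ := (hmem x).1 hx
    rw [hmem]
    obtain ⟨W, hW, h⟩ := aux_G hn α hα B V hV
    refine ⟨W, hW, ?_⟩
    rw [h, hcen]
    have hone : (1 : Matrix (Fin n) (Fin n) ℂ) = ∑ k, Vᴴ * Matrix.single k k 1 * V := by
      rw [← Matrix.sum_mul, ← Matrix.mul_sum]
      have : ∑ k, Matrix.single k k (1:ℂ) = (1 : Matrix (Fin n) (Fin n) ℂ) := by
        rw [Matrix.sum_single_eq_diagonal, Matrix.diagonal_one]
      rw [this, Matrix.mul_one]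
      exact hV.1.symm
    have hact : ∀ k, auxAct (α • (1 : Matrix (Fin n) (Fin n) ℝ) + (1 - α) • (Matrix.of fun _ _ => (1 / n : ℝ))) B k
        = α • B k + (1 - α) • ∑ l, (1 / n : ℝ) • B l := by
      intro k
      simp only [auxAct, Matrix.add_apply, Matrix.smul_apply, Matrix.of_apply, add_smul, Finset.sum_add_distrib,
        Matrix.one_apply, smul_eq_mul, Finset.smul_sum, smul_smul]
      simp
    simp only [auxPhi, hact, LinearMap.add_apply, LinearMap.smul_apply, Finset.sum_add_distrib, ← Finset.smul_sum,
      LinearMap.sum_apply]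
    congr 3
    rw [Finset.sum_comm]
    refine Finset.sum_congr rfl fun l _ => ?_
    conv_rhs => rw [hone]
    rw [map_sum]
  refine ⟨?_, hstar⟩
  have := hstar (L fun i => (1 : Matrix (Fin n) (Fin n) ℂ)ᴴ * A i * 1) ⟨1, one_mem _, rfl⟩ 0 (by simp)
  simpa using this
end

section
/- Let A_k = (a^{(k)}_{ij}) ∈ H_n for k = 1,...,m, and for 0 ≤ ε ≤ 1 let A_k(ε) ∈ H_n be the matrix with the same diagonal entries as A_k and with off-diagonal entries ε·a^{(k)}_{ij}. Then for every linear map L : (H_n)^m → ℝ², one has W_L(A₁(ε),...,A_m(ε)) ⊆ W_L(A₁,...,A_m). -/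
open Matrix

/-- `A(ε)`: keep the diagonal of `A` and multiply all off-diagonal entries by `ε`. -/
def scaleOffDiag {n : ℕ} (ε : ℝ) (A : Matrix (Fin n) (Fin n) ℂ) :
    Matrix (Fin n) (Fin n) ℂ :=
  Matrix.of fun i j => if i = j then A i j else (ε : ℂ) * A i j

/-- If a point of the filled (possibly degenerate) ellipse satisfies the degeneracy inequality,
it lies on the ellipse. -/
lemma ellipse_point (u v q : Fin 2 → ℝ) (a b : ℝ) (hab : a ^ 2 + b ^ 2 ≤ 1)
    (hq : q = a • u + b • v)
    (hg : (u 0 * v 1 - u 1 * v 0) ^ 2 - (q 0 * v 1 - q 1 * v 0) ^ 2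
      - (u 0 * q 1 - u 1 * q 0) ^ 2 ≤ 0) :
    ∃ a' b' : ℝ, a' ^ 2 + b' ^ 2 = 1 ∧ q = a' • u + b' • v := by
  have q0 : q 0 = a * u 0 + b * v 0 := by simp [hq]
  have q1 : q 1 = a * u 1 + b * v 1 := by simp [hq]
  by_cases hD : u 0 * v 1 - u 1 * v 0 = 0
  · obtain ⟨s, t, hst, h0, h1⟩ : ∃ s t : ℝ, 0 < s ^ 2 + t ^ 2 ∧ s * u 0 + t * v 0 = 0 ∧
        s * u 1 + t * v 1 = 0 := by
      by_cases hz : u 0 = 0 ∧ v 0 = 0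
      · by_cases hz' : u 1 = 0 ∧ v 1 = 0
        · exact ⟨1, 0, by norm_num, by simp [hz.1], by simp [hz'.1]⟩
        · refine ⟨v 1, -u 1, ?_, by simp [hz.1, hz.2], by ring⟩
          by_contra hn
          exact hz' ⟨by nlinarith [sq_nonneg (u 1), sq_nonneg (v 1)],
            by nlinarith [sq_nonneg (u 1), sq_nonneg (v 1)]⟩
      · refine ⟨v 0, -u 0, ?_, by ring, by linarith⟩
        by_contra hn
        exact hz ⟨by nlinarith [sq_nonneg (u 0), sq_nonneg (v 0)],
          by nlinarith [sq_nonneg (u 0), sq_nonneg (v 0)]⟩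
    have hd : 0 ≤ discrim (s ^ 2 + t ^ 2) (2 * (a * s + b * t)) (a ^ 2 + b ^ 2 - 1) := by
      unfold discrim
      nlinarith [sq_nonneg (2 * (a * s + b * t)),
        mul_nonneg hst.le (sub_nonneg.2 hab)]
    obtain ⟨τ, hτ⟩ := exists_quadratic_eq_zero hst.ne' ⟨_, (Real.mul_self_sqrt hd).symm⟩
    refine ⟨a + τ * s, b + τ * t, by linarith, ?_⟩
    ext i
    fin_cases i
    · simp [q0]; linear_combination -τ * h0
    · simp [q1]; linear_combination -τ * h1
  · refine ⟨a, b, le_antisymm hab ?_, hq⟩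
    rw [q0, q1] at hg
    have hp : 0 < (u 0 * v 1 - u 1 * v 0) ^ 2 := by positivity
    have : (u 0 * v 1 - u 1 * v 0) ^ 2 * (1 - (a ^ 2 + b ^ 2)) ≤ 0 := by
      linarith
    by_contra hn
    have := mul_pos hp (sub_pos.2 (not_le.1 hn))
    linarith

/-- Topological core: a connected compact family of ellipses through a common point. -/
lemma ellipse_family {X : Type*} [TopologicalSpace X] [T2Space X] (K : Set X)
    (hK : IsCompact K) (hKc : IsPreconnected K) (c u v : X → Fin 2 → ℝ)
    (hc : Continuous c) (hu : Continuous u) (hv : Continuous v) (x p : Fin 2 → ℝ)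
    (hx : ∀ y ∈ K, c y + u y = x)
    (δ : ℝ) (hδ : δ ^ 2 ≤ 1) (x0 : X) (hx0 : x0 ∈ K) (hp : p = c x0 + δ • u x0)
    (x1 : X) (hx1 : x1 ∈ K) (h1 : v x1 0 * (p 1 - x 1) - v x1 1 * (p 0 - x 0) = 0) :
    ∃ y ∈ K, ∃ a b : ℝ, a ^ 2 + b ^ 2 = 1 ∧ p = c y + a • u y + b • v y := by
  have hB : IsCompact {z : ℝ × ℝ | z.1 ^ 2 + z.2 ^ 2 ≤ 1} := by
    apply IsCompact.of_isClosed_subset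
      ((isCompact_Icc (a := (-1 : ℝ)) (b := 1)).prod (isCompact_Icc (a := (-1 : ℝ)) (b := 1)))
    · exact isClosed_le (by fun_prop) (by fun_prop)
    · rintro ⟨a, b⟩ h
      simp only [Set.mem_ofPred_eq] at h
      simp only [Set.mem_prod, Set.mem_Icc]
      refine ⟨⟨?_, ?_⟩, ?_, ?_⟩ <;> nlinarith [sq_nonneg a, sq_nonneg b]
  let S : Set X := Prod.fst '' ((K ×ˢ {z : ℝ × ℝ | z.1 ^ 2 + z.2 ^ 2 ≤ 1}) ∩
    {y : X × ℝ × ℝ | p = c y.1 + y.2.1 • u y.1 + y.2.2 • v y.1})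
  have hS : IsClosed S := by
    refine IsCompact.isClosed (IsCompact.image ?_ continuous_fst)
    refine (hK.prod hB).inter_right ?_
    exact isClosed_eq (by fun_prop) (by fun_prop)
  let g : X → ℝ := fun y => (u y 0 * v y 1 - u y 1 * v y 0) ^ 2
      - ((p 0 - c y 0) * v y 1 - (p 1 - c y 1) * v y 0) ^ 2
      - (u y 0 * (p 1 - c y 1) - u y 1 * (p 0 - c y 0)) ^ 2
  have hgc : Continuous g := by
    have := fun i => (continuous_apply i).comp hc
    have := fun i => (continuous_apply i).comp hu
    have := fun i => (continuous_apply i).comp hv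
    fun_prop
  have hT : IsClosed {y | g y ≤ 0} := isClosed_le hgc continuous_const
  have hcov : K ⊆ S ∪ {y | g y ≤ 0} := by
    intro y hy
    by_cases hgy : g y ≤ 0
    · exact Or.inr hgy
    · left
      have hgy : 0 < g y := not_le.1 hgy
      have hD : u y 0 * v y 1 - u y 1 * v y 0 ≠ 0 := by
        intro h
        simp only [g, h] at hgy
        nlinarith [sq_nonneg ((p 0 - c y 0) * v y 1 - (p 1 - c y 1) * v y 0),
          sq_nonneg (u y 0 * (p 1 - c y 1) - u y 1 * (p 0 - c y 0))]
      refine ⟨⟨y, ((p 0 - c y 0) * v y 1 - (p 1 - c y 1) * v y 0) /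
        (u y 0 * v y 1 - u y 1 * v y 0), (u y 0 * (p 1 - c y 1) - u y 1 * (p 0 - c y 0)) /
        (u y 0 * v y 1 - u y 1 * v y 0)⟩, ⟨⟨hy, ?_⟩, ?_⟩, rfl⟩
      · simp only [Set.mem_ofPred_eq, div_pow]
        rw [← add_div, div_le_one (by positivity)]
        simp only [g] at hgy
        linarith
      · simp only [Set.mem_ofPred_eq]
        have hi := mul_inv_cancel₀ hD
        ext i
        fin_cases i
        · simp only [Fin.zero_eta, Pi.add_apply, Pi.smul_apply, smul_eq_mul, div_eq_mul_inv]
          linear_combination (c y 0 - p 0) * hi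
        · simp only [Fin.mk_one, Pi.add_apply, Pi.smul_apply, smul_eq_mul, div_eq_mul_inv]
          linear_combination (c y 1 - p 1) * hi
  have hne0 : (K ∩ S).Nonempty :=
    ⟨x0, hx0, ⟨x0, δ, 0⟩, ⟨⟨hx0, by simpa using hδ⟩, by simpa using hp⟩, rfl⟩
  have hne1 : (K ∩ {y | g y ≤ 0}).Nonempty := by
    refine ⟨x1, hx1, ?_⟩
    have e := hx x1 hx1
    have e0 : x 0 = c x1 0 + u x1 0 := by simp [← e]
    have e1 : x 1 = c x1 1 + u x1 1 := by simp [← e]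
    rw [e0, e1] at h1
    have h2 : (p 0 - c x1 0) * v x1 1 - (p 1 - c x1 1) * v x1 0 =
        u x1 0 * v x1 1 - u x1 1 * v x1 0 := by linarith
    simp only [Set.mem_ofPred_eq, g, h2]
    nlinarith [sq_nonneg (u x1 0 * (p 1 - c x1 1) - u x1 1 * (p 0 - c x1 0))]
  obtain ⟨y, hy, ⟨⟨y', a, b⟩, ⟨⟨-, hab⟩, hpy⟩, rfl⟩, hgy⟩ :=
    isPreconnected_closed_iff.1 hKc _ _ hS hT hcov hne0 hne1
  simp only [Set.mem_ofPred_eq] at hab hpy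
  obtain ⟨a', b', h, h'⟩ := ellipse_point (u y') (v y') (p - c y') a b hab
    (by rw [hpy]; abel) (by simpa [g] using hgy)
  exact ⟨y', hy, a', b', h, by rw [add_assoc, ← h']; abel⟩

/-- The rank one matrix `w w*`. -/
noncomputable def rkOne {n : ℕ} (w : EuclideanSpace ℂ (Fin n)) : Matrix (Fin n) (Fin n) ℂ :=
  vecMulVec (fun i => w i) (star fun i => w i)

lemma rkOne_continuous {n : ℕ} : Continuous (rkOne (n := n)) := by
  unfold rkOne
  refine continuous_matrix fun i j => ?_
  simp only [vecMulVec_apply, Pi.star_apply]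
  fun_prop

lemma rkOne_herm {n : ℕ} (w : EuclideanSpace ℂ (Fin n)) : (rkOne w)ᴴ = rkOne w := by
  ext i j
  simp [rkOne, vecMulVec_apply, mul_comm]

lemma rkOne_idem {n : ℕ} (w : EuclideanSpace ℂ (Fin n)) (hw : ‖w‖ = 1) :
    rkOne w * rkOne w = rkOne w := by
  have h : (star fun i => w i) ⬝ᵥ (fun i => w i) = 1 := by
    have h2 := EuclideanSpace.norm_sq_eq w
    rw [hw] at h2
    have : ((∑ i, ‖w i‖ ^ 2 : ℝ) : ℂ) = 1 := by rw [← h2]; simp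
    rw [← this]
    simp [dotProduct, Complex.conj_mul']
  unfold rkOne
  rw [vecMulVec_mul_vecMulVec, h]
  simp

/-- One step: scale row and column `a`. -/
noncomputable def rowScale {n : ℕ} (δ : ℝ) (P A : Matrix (Fin n) (Fin n) ℂ) : Matrix (Fin n) (Fin n) ℂ :=
  ((1 - P) * A * (1 - P) + P * A * P) + δ • ((1 - P) * A * P + P * A * (1 - P))

lemma step_aux {n m : ℕ} (A : Fin m → Matrix (Fin n) (Fin n) ℂ) (δ : ℝ) (hδ : δ ^ 2 ≤ 1)
    (a : Fin n) (L : (Fin m → Matrix (Fin n) (Fin n) ℂ) →ₗ[ℝ] (Fin 2 → ℝ)) :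
    ∃ U ∈ Matrix.unitaryGroup (Fin n) ℂ,
      L (fun k => rowScale δ (rkOne (EuclideanSpace.single a 1)) (A k)) =
        L fun k => Uᴴ * A k * U := by
  have hL : Continuous L := L.continuous_of_finiteDimensional
  let E := EuclideanSpace ℂ (Fin n)
  let K : Set E := Metric.sphere 0 1
  have hK : IsCompact K := isCompact_sphere _ _
  have hKc : IsPreconnected K := by
    apply isPreconnected_sphere
    have h : Module.finrank ℝ E = 2 * n := by
      rw [← Module.finrank_mul_finrank ℝ ℂ E]
      simp [E]
    have hn : 0 < n := a.pos
    rw [← Module.finrank_eq_rank, h]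
    exact_mod_cast (by omega : 1 < 2 * n)
  let c : E → Fin 2 → ℝ := fun w => L fun k =>
    (1 - rkOne w) * A k * (1 - rkOne w) + rkOne w * A k * rkOne w
  let u : E → Fin 2 → ℝ := fun w => L fun k =>
    (1 - rkOne w) * A k * rkOne w + rkOne w * A k * (1 - rkOne w)
  let v : E → Fin 2 → ℝ := fun w => L fun k => Complex.I • (A k * rkOne w - rkOne w * A k)
  have hr := rkOne_continuous (n := n)
  have hc : Continuous c := hL.comp (by fun_prop)
  have hu : Continuous u := hL.comp (by fun_prop)
  have hv : Continuous v := hL.comp (by fun_prop)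
  let p := L (fun k => rowScale δ (rkOne (EuclideanSpace.single a 1)) (A k))
  let x := L A
  have hx : ∀ y ∈ K, c y + u y = x := by
    intro y _
    simp only [c, u, x, ← map_add]
    congr 1
    ext1 k
    simp only [Pi.add_apply]
    noncomm_ring
  have hsK : ∀ i, (EuclideanSpace.single i 1 : E) ∈ K := by
    intro i; simp [K]
  have hp : p = c (EuclideanSpace.single a 1) + δ • u (EuclideanSpace.single a 1) := by
    simp only [c, u, p, ← map_add, ← map_smul]
    rfl
  let h : E → ℝ := fun w => v w 0 * (p 1 - x 1) - v w 1 * (p 0 - x 0)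
  have hh : Continuous h := by
    have := fun i => (continuous_apply i).comp hv
    fun_prop
  have hsumP : ∑ i, rkOne (EuclideanSpace.single i 1 : E) = 1 := by
    ext i j
    simp [Matrix.sum_apply, rkOne, vecMulVec_apply, Matrix.one_apply, Pi.single_apply]
  have hsumv : ∑ i, v (EuclideanSpace.single i 1) = 0 := by
    simp only [v, ← map_sum]
    convert map_zero L
    ext1 k
    simp only [Finset.sum_apply, ← Finset.smul_sum, Finset.sum_sub_distrib, ← Finset.mul_sum,
      ← Finset.sum_mul, hsumP]
    simp
  have hsum : ∑ i, h (EuclideanSpace.single i 1) = 0 := by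
    have e : ∀ j, ∑ i, v (EuclideanSpace.single i 1) j = 0 := by
      intro j
      have := congrFun hsumv j
      simpa using this
    simp only [h, Finset.sum_sub_distrib, ← Finset.sum_mul, e]
    simp
  have hne : (Finset.univ : Finset (Fin n)).Nonempty := ⟨a, Finset.mem_univ a⟩
  obtain ⟨i, -, hi⟩ := Finset.exists_le_of_sum_le hne
    (f := fun i => h (EuclideanSpace.single i 1)) (g := fun _ => 0) (by simp [hsum])
  obtain ⟨j, -, hj⟩ := Finset.exists_le_of_sum_le hne
    (g := fun i => h (EuclideanSpace.single i 1)) (f := fun _ => 0) (by simp [hsum])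
  obtain ⟨x1, hx1, h1⟩ := hKc.intermediate_value (hsK i) (hsK j) hh.continuousOn ⟨hi, hj⟩
  obtain ⟨y, hy, s, t, hst, hfin⟩ := ellipse_family K hK hKc c u v hc hu hv x p hx δ hδ _
    (hsK a) hp x1 hx1 h1
  have hPP := rkOne_idem y (by simpa [K] using hy)
  have hPH := rkOne_herm y
  let z : ℂ := s + t * Complex.I
  have hzz : star z * z = 1 := by
    have : ((s ^ 2 + t ^ 2 : ℝ) : ℂ) = 1 := by rw [hst]; simp
    simp [z]
    push_cast at this
    linear_combination this - t ^ 2 * Complex.I_sq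
  have hUH : ((1 - rkOne y) + z • rkOne y)ᴴ = (1 - rkOne y) + star z • rkOne y := by
    simp [hPH]
  refine ⟨(1 - rkOne y) + z • rkOne y, ?_, ?_⟩
  · rw [Matrix.mem_unitaryGroup_iff', Matrix.star_eq_conjTranspose, hUH]
    have e1 : (star z • rkOne y) * (z • rkOne y) = rkOne y := by
      rw [smul_mul_assoc, mul_smul_comm, smul_smul, hzz, one_smul, hPP]
    have e2 : (1 - rkOne y) * (z • rkOne y) = 0 := by
      rw [mul_smul_comm, sub_mul, hPP, one_mul, sub_self, smul_zero]
    have e3 : (star z • rkOne y) * (1 - rkOne y) = 0 := by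
      rw [smul_mul_assoc, mul_sub, hPP, mul_one, sub_self, smul_zero]
    have e4 : (1 - rkOne y) * (1 - rkOne y) = 1 - rkOne y := by
      rw [mul_sub, sub_mul, sub_mul, hPP]; simp
    rw [add_mul, mul_add, mul_add, e1, e2, e3, e4]
    simp
  · change p = _
    rw [hfin]
    simp only [c, u, v, ← map_add, ← map_smul, hUH]
    congr 1
    ext1 k
    simp only [Pi.add_apply, Pi.smul_apply]
    generalize rkOne y = P
    generalize A k = B
    have e1 : star z = s - t * Complex.I := by simp [z, sub_eq_add_neg]
    have e2 : star z • P * B * (z • P) = P * B * P := by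
      rw [smul_mul_assoc, smul_mul_assoc, mul_smul_comm, smul_smul, hzz, one_smul]
    have e3 : B * P - P * B = (1 - P) * B * P - P * B * (1 - P) := by noncomm_ring
    have e4 : ∀ (r : ℝ) (M : Matrix (Fin n) (Fin n) ℂ), r • M = (r : ℂ) • M := by
      intro r M; ext i j; simp
    rw [e3]
    rw [add_mul, mul_add, add_mul, add_mul, e2]
    rw [e1, e4, e4]
    simp only [z, smul_mul_assoc, mul_smul_comm]
    module

lemma step_sub {n m : ℕ} (A : Fin m → Matrix (Fin n) (Fin n) ℂ) (δ : ℝ) (hδ : δ ^ 2 ≤ 1)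
    (a : Fin n) (L : (Fin m → Matrix (Fin n) (Fin n) ℂ) →ₗ[ℝ] (Fin 2 → ℝ)) :
    LNumericalRange L (fun k => rowScale δ (rkOne (EuclideanSpace.single a 1)) (A k)) ⊆
      LNumericalRange L A := by
  rintro _ ⟨V, hV, rfl⟩
  let C : (Fin m → Matrix (Fin n) (Fin n) ℂ) →ₗ[ℝ] (Fin m → Matrix (Fin n) (Fin n) ℂ) :=
    { toFun := fun X k => Vᴴ * X k * V
      map_add' := by intro X Y; ext1 k; simp [mul_add, add_mul]
      map_smul' := by intro r X; ext1 k; simp }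
  obtain ⟨U, hU, h⟩ := step_aux A δ hδ a (L ∘ₗ C)
  refine ⟨U * V, mul_mem hU hV, ?_⟩
  refine h.trans ?_
  simp only [LinearMap.comp_apply, C, LinearMap.coe_mk, AddHom.coe_mk, conjTranspose_mul]
  congr 1
  ext1 k
  noncomm_ring

/-- Scale by `δ` for each of row and column index in `s`, off the diagonal. -/
def finScale {n : ℕ} (δ : ℝ) (s : Finset (Fin n)) (A : Matrix (Fin n) (Fin n) ℂ) :
    Matrix (Fin n) (Fin n) ℂ :=
  Matrix.of fun i j => if i = j then A i j else
    (if i ∈ s then (δ : ℂ) else 1) * (if j ∈ s then (δ : ℂ) else 1) * A i j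

lemma finScale_insert {n : ℕ} (δ : ℝ) (s : Finset (Fin n)) (a : Fin n) (ha : a ∉ s)
    (A : Matrix (Fin n) (Fin n) ℂ) :
    finScale δ (insert a s) A =
      rowScale δ (rkOne (EuclideanSpace.single a 1)) (finScale δ s A) := by
  have hP : rkOne (EuclideanSpace.single a (1 : ℂ)) =
      diagonal (fun i => if i = a then (1 : ℂ) else 0) := by
    ext i j
    simp only [rkOne, vecMulVec_apply, diagonal_apply, Pi.star_apply, EuclideanSpace.single_apply]
    split_ifs <;> simp_all
  have hQ : 1 - rkOne (EuclideanSpace.single a (1 : ℂ)) =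
      diagonal (fun i => if i = a then (0 : ℂ) else 1) := by
    rw [hP, ← diagonal_one, diagonal_sub]
    congr 1; ext i; split_ifs <;> simp
  rw [rowScale, hQ, hP]
  ext i j
  simp only [Matrix.add_apply, Matrix.smul_apply, mul_diagonal, diagonal_mul, finScale,
    Matrix.of_apply, Finset.mem_insert, Complex.real_smul]
  by_cases hi : i = a <;> by_cases hj : j = a
  · simp [hi, hj]
  · have : ¬ a = j := fun h => hj h.symm
    simp [hi, hj, ha, this, mul_assoc]
  · simp [hi, hj, ha]; ring
  · simp [hi, hj]

lemma finScale_sub {n m : ℕ} (A : Fin m → Matrix (Fin n) (Fin n) ℂ) (δ : ℝ) (hδ : δ ^ 2 ≤ 1)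
    (L : (Fin m → Matrix (Fin n) (Fin n) ℂ) →ₗ[ℝ] (Fin 2 → ℝ)) (s : Finset (Fin n)) :
    LNumericalRange L (fun k => finScale δ s (A k)) ⊆ LNumericalRange L A := by
  induction s using Finset.induction_on with
  | empty =>
    have : (fun k => finScale δ ∅ (A k)) = A := by
      ext k i j
      simp [finScale]
    rw [this]
  | insert a s ha ih =>
    simp only [finScale_insert δ s a ha]
    exact (step_sub _ δ hδ a L).trans ih

/-- For Hermitian `A₁, ..., A_m`, `ε ∈ [0,1]` and any linear `L : H_n^m → ℝ²`,
`W_L(A₁(ε),...,A_m(ε)) ⊆ W_L(A₁,...,A_m)`. -/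
theorem stmt13 {n m : ℕ} (A : Fin m → Matrix (Fin n) (Fin n) ℂ)
    (hA : ∀ k, (A k).IsHermitian) (ε : ℝ) (hε : ε ∈ Set.Icc (0 : ℝ) 1)
    (L : (Fin m → Matrix (Fin n) (Fin n) ℂ) →ₗ[ℝ] (Fin 2 → ℝ)) :
    LNumericalRange L (fun k => scaleOffDiag ε (A k)) ⊆ LNumericalRange L A := by
  have h := finScale_sub A (Real.sqrt ε) (by rw [Real.sq_sqrt hε.1]; exact hε.2) L Finset.univ
  have e : (fun k => finScale (Real.sqrt ε) Finset.univ (A k)) =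
      fun k => scaleOffDiag ε (A k) := by
    ext k i j
    have : ((Real.sqrt ε : ℝ) : ℂ) * (Real.sqrt ε : ℝ) = (ε : ℂ) := by
      rw [← Complex.ofReal_mul, Real.mul_self_sqrt hε.1]
    simp [finScale, scaleOffDiag, this]
  rwa [e] at h
end
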